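/- arXiv:2512.16585 — 7 statements merged into one kernel-verified Lean document; each statement's English description precedes it below -/
import Mathlib

section
/- Let L be a nilpotent Lie ring with L ⊗ ℝ of nilpotency class c, let ‖·‖ be a norm on L, let l be a Guivarc'h length on L, and let 𝒫 be any set of finite-index ideals of L. Then RF_{L,𝒫,‖·‖}(r) ⪯ RF_{L,𝒫,l}(r) and RF_{L,𝒫,l}(r) ⪯ RF_{L,𝒫,‖·‖}(r^c), i.e. there is C > 0 with RF_{L,𝒫,‖·‖}(r) ≤ C·RF_{L,𝒫,l}(C·r) and RF_{L,𝒫,l}(r) ≤ C·RF_{L,𝒫,‖·‖}((C·r)^c) for all sufficiently large r. -/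
noncomputable section

/-- Word norm of `g` with respect to generating set `S`: the least `k` such that `g` is a
product of `k` elements of `S ∪ S⁻¹`. -/
def wordNorm {G : Type*} [Group G] (S : Set G) (g : G) : ℕ :=
  sInf {k | ∃ l : List G, l.length = k ∧ (∀ x ∈ l, x ∈ S ∨ x⁻¹ ∈ S) ∧ l.prod = g}

/-- Divisibility function relative to a family `P` of subgroups:
`min {[G:N] : N ∈ P, g ∉ N, [G:N] < ∞}`. -/
def groupDivP {G : Type*} [Group G] (P : Set (Subgroup G)) (g : G) : ℕ :=
  sInf {k | ∃ N ∈ P, g ∉ N ∧ N.index = k ∧ k ≠ 0}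

/-- Residual finiteness growth relative to a family of subgroups `P`:
`max {D_{G,P}(g) : 0 < ‖g‖_{G,S} ≤ r}`. -/
def groupRFP (G : Type*) [Group G] (P : Set (Subgroup G)) (S : Set G) (r : ℝ) : ℕ :=
  sSup {d | ∃ g : G, 0 < wordNorm S g ∧ (wordNorm S g : ℝ) ≤ r ∧ groupDivP P g = d}

/-- Residual finiteness growth of a group, via all finite-index normal subgroups. -/
def groupRF (G : Type*) [Group G] (S : Set G) (r : ℝ) : ℕ :=
  groupRFP G {N | N.Normal} S r

/-- `f ⪯ g` : there is `C > 0` with `f r ≤ C * g (C * r)` for all `r ≥ max 1 (1/C)`. -/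
def FDom (f g : ℝ → ℝ) : Prop :=
  ∃ C : ℝ, 0 < C ∧ ∀ r : ℝ, max 1 (1 / C) ≤ r → f r ≤ C * g (C * r)

/-- `f ≈ g`. -/
def FEquiv (f g : ℝ → ℝ) : Prop :=
  FDom f g ∧ FDom g f

end

open scoped TensorProduct

noncomputable section

/-- The index of a Lie ideal of a Lie ring `L` as an additive subgroup. -/
def idealIndex {L : Type*} [LieRing L] (I : LieIdeal ℤ L) : ℕ :=
  AddSubgroup.index (LieSubmodule.toSubmodule I).toAddSubgroup

/-- Divisibility function of a Lie ring relative to a family `P` of ideals: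
`min {[L:I] : I ∈ P, v ∉ I, [L:I] < ∞}`. -/
def lieDivP {L : Type*} [LieRing L] (P : Set (LieIdeal ℤ L)) (v : L) : ℕ :=
  sInf {k | ∃ I ∈ P, v ∉ I ∧ idealIndex I = k ∧ k ≠ 0}

/-- Residual finiteness growth of a Lie ring w.r.t. a length function `ℓ` and
a family `P` of ideals. -/
def lieRFP (L : Type*) [LieRing L] (P : Set (LieIdeal ℤ L)) (ℓ : L → ℝ) (r : ℝ) : ℕ :=
  sSup {d | ∃ v : L, 0 < ℓ v ∧ ℓ v ≤ r ∧ lieDivP P v = d}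

/-- Residual finiteness growth of a Lie ring w.r.t. a length function `ℓ`, using all
finite-index ideals. -/
def lieRF (L : Type*) [LieRing L] (ℓ : L → ℝ) (r : ℝ) : ℕ :=
  lieRFP L Set.univ ℓ r

/-- A vector space norm on a real vector space. -/
def IsVectorNorm {V : Type*} [AddCommGroup V] [Module ℝ V] (N : V → ℝ) : Prop :=
  (∀ x, 0 ≤ N x) ∧ (∀ x, N x = 0 ↔ x = 0) ∧ (∀ (r : ℝ) (x), N (r • x) = |r| * N x) ∧
    ∀ x y, N (x + y) ≤ N x + N y

/-- A norm on a Lie ring `L`: the restriction of a vector space norm on `ℝ ⊗ L` along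
the canonical map `v ↦ 1 ⊗ v`. -/
def IsLieRingNorm {L : Type*} [LieRing L] (ν : L → ℝ) : Prop :=
  ∃ N : (ℝ ⊗[ℤ] L) → ℝ, IsVectorNorm N ∧ ∀ v : L, ν v = N ((1 : ℝ) ⊗ₜ[ℤ] v)

/-- A Guivarc'h length on a Lie ring `L`, where `L ⊗ ℝ` is nilpotent of class (at most) `c`:
there are subspaces `𝔞ᵢ` with `γᵢ(L ⊗ ℝ) = 𝔞ᵢ ⊕ ⋯ ⊕ 𝔞_c`, norms `nᵢ` on the `𝔞ᵢ`, and
(necessarily unique) component projections `comp i`, such that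
`ℓ v = max_i nᵢ(vᵢ)^(1/i)` where `v = v₁ + ⋯ + v_c` in `L ⊗ ℝ`.
(Mathlib's `lowerCentralSeries _ _ _ (i : ℕ)` is `γ_{i+1}` of the paper, and the component
`i : Fin c` corresponds to the paper's index `i + 1`.) -/
def IsGuivarchLength {L : Type*} [LieRing L] (c : ℕ) (ℓ : L → ℝ) : Prop :=
  ∃ (a : Fin c → Submodule ℝ (ℝ ⊗[ℤ] L)) (n : Fin c → (ℝ ⊗[ℤ] L) → ℝ)
    (comp : Fin c → (ℝ ⊗[ℤ] L) → (ℝ ⊗[ℤ] L)),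
    LieModule.lowerCentralSeries ℝ (ℝ ⊗[ℤ] L) (ℝ ⊗[ℤ] L) c = ⊥ ∧
    (∀ i : Fin c,
      LieSubmodule.toSubmodule (LieModule.lowerCentralSeries ℝ (ℝ ⊗[ℤ] L) (ℝ ⊗[ℤ] L) (i : ℕ)) =
        ⨆ (j : Fin c) (_ : i ≤ j), a j) ∧
    iSupIndep a ∧
    (∀ i, ∀ x ∈ a i, 0 ≤ n i x) ∧
    (∀ i, ∀ x ∈ a i, (n i x = 0 ↔ x = 0)) ∧
    (∀ i (r : ℝ), ∀ x ∈ a i, n i (r • x) = |r| * n i x) ∧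
    (∀ i, ∀ x ∈ a i, ∀ y ∈ a i, n i (x + y) ≤ n i x + n i y) ∧
    (∀ i v, comp i v ∈ a i) ∧
    (∀ v, ∑ i, comp i v = v) ∧
    (∀ v : L, ℓ v = ⨆ i : Fin c, n i (comp i ((1 : ℝ) ⊗ₜ[ℤ] v)) ^ (((i : ℕ) : ℝ) + 1)⁻¹)

end

theorem exists_seminorm_le_mul_norm {V : Type*} [AddCommGroup V] [Module ℝ V]
    [Module.Finite ℝ V] {N p : V → ℝ} (hN : IsVectorNorm N)
    (hp_smul : ∀ (r : ℝ) x, p (r • x) = |r| * p x) (hp_add : ∀ x y, p (x + y) ≤ p x + p y) :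
    ∃ K : ℝ, 0 ≤ K ∧ ∀ x, p x ≤ K * N x := by
  obtain ⟨hN_nonneg, hN_zero, hN_smul, hN_add⟩ := hN
  let : Norm V := ⟨N⟩
  have core : NormedSpace.Core ℝ V :=
    { norm_nonneg := hN_nonneg
      norm_smul := fun r x => hN_smul r x
      norm_triangle := hN_add
      norm_eq_zero_iff := hN_zero }
  let : NormedAddCommGroup V := NormedAddCommGroup.ofCore core
  let : NormedSpace ℝ V := NormedSpace.ofCore core
  let b := Module.finBasis ℝ V
  let P : Seminorm ℝ V := Seminorm.of p hp_add hp_smul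
  let f (i) : V →L[ℝ] ℝ := LinearMap.toContinuousLinearMap (b.coord i)
  refine ⟨∑ i, ‖f i‖ * P (b i), Finset.sum_nonneg fun i _ => by positivity, fun x => ?_⟩
  change P x ≤ (∑ i, ‖f i‖ * P (b i)) * ‖x‖
  calc P x = P (∑ i, b.repr x i • b i) := by rw [b.sum_repr]
    _ ≤ ∑ i, P (b.repr x i • b i) :=
      Finset.le_sum_of_subadditive _ (map_zero P).le (map_add_le_add P) _ _
    _ = ∑ i, ‖f i x‖ * P (b i) := Finset.sum_congr rfl fun i _ => map_smul_eq_mul P _ _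
    _ ≤ ∑ i, ‖f i‖ * ‖x‖ * P (b i) := by
      gcongr with i
      exact (f i).le_opNorm x
    _ = _ := by
      rw [Finset.sum_mul]
      exact Finset.sum_congr rfl fun i _ => by ring

namespace IsLieRingNorm

variable {L : Type*} [LieRing L] {ν : L → ℝ}

theorem pos_iff (hν : IsLieRingNorm ν) {v : L} :
    0 < ν v ↔ (1 : ℝ) ⊗ₜ[ℤ] v ≠ 0 := by
  obtain ⟨N, ⟨hN_nonneg, hN_zero, -, -⟩, hνN⟩ := hν
  rw [hνN, (hN_nonneg _).lt_iff_ne', Ne, hN_zero]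

theorem finite_setOf_le [Module.Free ℤ L] [Module.Finite ℤ L] (hν : IsLieRingNorm ν) (r : ℝ) :
    {v : L | ν v ≤ r}.Finite := by
  obtain ⟨N, hN, hνN⟩ := hν
  let b := Module.Free.chooseBasis ℤ L
  let bV := b.baseChange ℝ
  have hbound (i) : ∃ K : ℝ, 0 ≤ K ∧ ∀ x, |bV.repr x i| ≤ K * N x :=
    exists_seminorm_le_mul_norm hN (fun s x => by simp [abs_mul])
      (fun x y => by simpa using abs_add_le (bV.repr x i) (bV.repr y i))
  choose K hK_nonneg hK using hbound
  refine Set.Finite.subset (Set.Finite.preimage b.equivFun.injective.injOn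
    (Set.finite_Icc (fun i => -⌊K i * r⌋) (fun i => ⌊K i * r⌋))) fun v hv => ?_
  have hcoord (i) : |b.repr v i| ≤ ⌊K i * r⌋ := by
    rw [Int.le_floor]
    calc ((|b.repr v i| : ℤ) : ℝ) = |bV.repr ((1 : ℝ) ⊗ₜ[ℤ] v) i| := by
          simp [bV, Module.Basis.baseChange_repr_tmul]
      _ ≤ K i * N ((1 : ℝ) ⊗ₜ[ℤ] v) := hK i _
      _ ≤ K i * r := mul_le_mul_of_nonneg_left (hνN v ▸ hv) (hK_nonneg i)
  exact ⟨fun i => (abs_le.mp (hcoord i)).1, fun i => (abs_le.mp (hcoord i)).2⟩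

theorem exists_guivarch_comparison [Module.Finite ℤ L] (hν : IsLieRingNorm ν) {c : ℕ}
    {ℓ : L → ℝ} (hℓ : IsGuivarchLength c ℓ) :
    ∃ K : ℝ, 1 ≤ K ∧ ∀ r : ℝ, 1 ≤ r → ∀ v : L,
      (0 < ν v → ν v ≤ r → 0 < ℓ v ∧ ℓ v ≤ K * r) ∧
      (0 < ℓ v → ℓ v ≤ r → 0 < ν v ∧ ν v ≤ (K * r) ^ c) := by
  have hpos (v : L) := hν.pos_iff (v := v)
  obtain ⟨N, hN, hνN⟩ := hν
  obtain ⟨a, n, comp, -, -, ha, hn_nonneg, hn_zero, hn_smul, hn_add, hmem, hsum, hℓ⟩ := hℓ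
  have huniq (w : Fin c → ℝ ⊗[ℤ] L) (v) (hw : ∀ i, w i ∈ a i) (h : ∑ i, w i = v) (i) :
      comp i v = w i :=
    (iSupIndep_iff_finsetSum_eq_imp_eq a).mp ha Finset.univ (fun i => comp i v) w
      (fun i _ => ⟨hmem i v, hw i⟩) ((hsum v).trans h.symm) i (Finset.mem_univ i)
  have hcomp_add (i x y) : comp i (x + y) = comp i x + comp i y :=
    huniq (fun i => comp i x + comp i y) _ (fun i => add_mem (hmem i x) (hmem i y))
      (by rw [Finset.sum_add_distrib, hsum, hsum]) i
  have hcomp_smul (i) (s : ℝ) (x) : comp i (s • x) = s • comp i x :=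
    huniq (fun i => s • comp i x) _ (fun i => (a i).smul_mem s (hmem i x))
      (by rw [← Finset.smul_sum, hsum]) i
  have hupper (i) : ∃ K : ℝ, 0 ≤ K ∧ ∀ x, n i (comp i x) ≤ K * N x :=
    exists_seminorm_le_mul_norm hN
      (fun s x => by rw [hcomp_smul, hn_smul i s _ (hmem i x)])
      (fun x y => by rw [hcomp_add]; exact hn_add i _ (hmem i x) _ (hmem i y))
  have hlower (i) : ∃ K : ℝ, 0 ≤ K ∧ ∀ x : a i, N x ≤ K * n i x :=
    exists_seminorm_le_mul_norm (N := fun x : a i => n i x) (p := fun x : a i => N x)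
      ⟨fun x => hn_nonneg i x x.2, fun x => by rw [hn_zero i x x.2, Submodule.coe_eq_zero],
        fun s x => hn_smul i s x x.2, fun x y => hn_add i x x.2 y y.2⟩
      (fun s x => hN.2.2.1 s x) (fun x y => hN.2.2.2 x y)
  choose A hA_nonneg hA using hupper
  choose B hB_nonneg hB using hlower
  have hn_nonneg' (i x) : 0 ≤ n i (comp i x) := hn_nonneg i _ (hmem i x)
  have hterm_le (v : L) (i) :
      n i (comp i ((1 : ℝ) ⊗ₜ[ℤ] v)) ^ (((i : ℕ) : ℝ) + 1)⁻¹ ≤ ℓ v :=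
    hℓ v ▸ le_ciSup (f := fun i : Fin c => n i (comp i ((1 : ℝ) ⊗ₜ[ℤ] v)) ^ (((i : ℕ) : ℝ) + 1)⁻¹)
      (Set.finite_range _).bddAbove i
  have hℓ_pos (v : L) : 0 < ℓ v ↔ (1 : ℝ) ⊗ₜ[ℤ] v ≠ 0 := by
    constructor
    · intro h hv
      refine h.ne' ?_
      have hz (i) : comp i (0 : ℝ ⊗[ℤ] L) = 0 := by simpa using hcomp_smul i 0 0
      rw [hℓ, hv]
      refine (iSup_congr fun i => ?_).trans Real.iSup_const_zero
      rw [hz, (hn_zero i 0 (zero_mem _)).mpr rfl, Real.zero_rpow (by positivity)]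
    · intro h
      obtain ⟨i, hi⟩ : ∃ i, comp i ((1 : ℝ) ⊗ₜ[ℤ] v) ≠ 0 := by
        by_contra! hzero
        exact h (by rw [← hsum ((1 : ℝ) ⊗ₜ[ℤ] v)]; exact Finset.sum_eq_zero fun i _ => hzero i)
      refine lt_of_lt_of_le (Real.rpow_pos_of_pos ?_ _) (hterm_le v i)
      exact (hn_nonneg' i _).lt_of_ne' fun h0 => hi ((hn_zero i _ (hmem i _)).mp h0)
  have hA_sum := Finset.sum_nonneg fun i (_ : i ∈ Finset.univ) => hA_nonneg i
  have hB_sum := Finset.sum_nonneg fun i (_ : i ∈ Finset.univ) => hB_nonneg i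
  have hK : 1 ≤ 1 + ∑ i, A i + ∑ i, B i := by linarith
  refine ⟨1 + ∑ i, A i + ∑ i, B i, hK, fun r hr v => ⟨fun h0 hle => ?_, fun h0 hle => ?_⟩⟩
  · have hv := (hpos v).mp h0
    refine ⟨(hℓ_pos v).mpr hv, ?_⟩
    have hKr : 1 ≤ (1 + ∑ i, A i + ∑ i, B i) * r := one_le_mul_of_one_le_of_one_le hK hr
    rw [hℓ]
    refine Real.iSup_le (fun i => ?_) (by linarith)
    have hle' : n i (comp i ((1 : ℝ) ⊗ₜ[ℤ] v)) ≤ (1 + ∑ i, A i + ∑ i, B i) * r := by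
      refine (hA i _).trans ?_
      rw [← hνN]
      have := Finset.single_le_sum (fun i _ => hA_nonneg i) (Finset.mem_univ i)
      exact mul_le_mul (by linarith) hle h0.le (by linarith)
    calc _ ≤ ((1 + ∑ i, A i + ∑ i, B i) * r) ^ (((i : ℕ) : ℝ) + 1)⁻¹ :=
          Real.rpow_le_rpow (hn_nonneg' i _) hle' (by positivity)
      _ ≤ ((1 + ∑ i, A i + ∑ i, B i) * r) ^ (1 : ℝ) :=
          Real.rpow_le_rpow_of_exponent_le hKr
            (inv_le_one_of_one_le₀ (by linarith [Nat.cast_nonneg (α := ℝ) (i : ℕ)]))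
      _ = _ := Real.rpow_one _
  · have hv := (hℓ_pos v).mp h0
    refine ⟨(hpos v).mpr hv, ?_⟩
    have hc : c ≠ 0 := by
      rintro rfl
      exact hv (by simpa using (hsum ((1 : ℝ) ⊗ₜ[ℤ] v)).symm)
    have hcomp_le (i) : n i (comp i ((1 : ℝ) ⊗ₜ[ℤ] v)) ≤ r ^ c := by
      have h1 := (hterm_le v i).trans hle
      rw [Real.rpow_inv_le_iff_of_pos (hn_nonneg' i _) (by linarith) (by positivity)] at h1
      refine h1.trans ?_
      rw [← Real.rpow_natCast]
      exact Real.rpow_le_rpow_of_exponent_le hr (by exact_mod_cast i.2)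
    calc ν v = N (∑ i, comp i ((1 : ℝ) ⊗ₜ[ℤ] v)) := by rw [hνN, hsum]
      _ ≤ ∑ i, N (comp i ((1 : ℝ) ⊗ₜ[ℤ] v)) :=
          Finset.le_sum_of_subadditive _ ((hN.2.1 0).mpr rfl).le hN.2.2.2 _ _
      _ ≤ ∑ i, B i * r ^ c := Finset.sum_le_sum fun i _ =>
          (hB i ⟨_, hmem i _⟩).trans (mul_le_mul_of_nonneg_left (hcomp_le i) (hB_nonneg i))
      _ = (∑ i, B i) * r ^ c := by rw [Finset.sum_mul]
      _ ≤ (1 + ∑ i, A i + ∑ i, B i) ^ c * r ^ c := by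
          gcongr
          exact le_trans (by linarith) (le_self_pow₀ hK hc)
      _ = _ := (mul_pow _ _ _).symm

end IsLieRingNorm

theorem lieRFP_le_lieRFP {L : Type*} [LieRing L] (P : Set (LieIdeal ℤ L)) {f g : L → ℝ} {r s : ℝ}
    (hfin : {v : L | 0 < g v ∧ g v ≤ s}.Finite)
    (h : ∀ v, 0 < f v → f v ≤ r → 0 < g v ∧ g v ≤ s) :
    lieRFP L P f r ≤ lieRFP L P g s := by
  refine csSup_le_csSup' ((hfin.image (lieDivP P)).subset ?_).bddAbove ?_
  · rintro _ ⟨v, h0, hv, rfl⟩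
    exact ⟨v, ⟨h0, hv⟩, rfl⟩
  · rintro _ ⟨v, h0, hv, rfl⟩
    exact ⟨v, (h v h0 hv).1, (h v h0 hv).2, rfl⟩


/-- For a nilpotent Lie ring `L` with `L ⊗ ℝ` of nilpotency class `c`, a norm
`ν` on `L`, a Guivarc'h length `ℓ` on `L` and any set `P` of finite-index ideals of `L`:
`RF_{L,P,ν}(r) ⪯ RF_{L,P,ℓ}(r)` and `RF_{L,P,ℓ}(r) ⪯ RF_{L,P,ν}(r^c)`. -/
theorem rf_norm_vs_guivarch
    {L : Type*} [LieRing L] [Module.Free ℤ L] [Module.Finite ℤ L]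
    (c : ℕ)
    (hc : LieModule.lowerCentralSeries ℝ (ℝ ⊗[ℤ] L) (ℝ ⊗[ℤ] L) c = ⊥)
    (hc' : ∀ k < c, LieModule.lowerCentralSeries ℝ (ℝ ⊗[ℤ] L) (ℝ ⊗[ℤ] L) k ≠ ⊥)
    (ν : L → ℝ) (hν : IsLieRingNorm ν)
    (ℓ : L → ℝ) (hℓ : IsGuivarchLength c ℓ)
    (P : Set (LieIdeal ℤ L)) (hP : ∀ I ∈ P, idealIndex I ≠ 0) :
    ∃ C : ℝ, 0 < C ∧ ∃ r₀ : ℝ, ∀ r : ℝ, r₀ ≤ r →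
      (lieRFP L P ν r : ℝ) ≤ C * (lieRFP L P ℓ (C * r) : ℝ) ∧
      (lieRFP L P ℓ r : ℝ) ≤ C * (lieRFP L P ν ((C * r) ^ c) : ℝ) := by
  obtain ⟨K, hK, hcomp⟩ := hν.exists_guivarch_comparison hℓ
  refine ⟨K, by linarith, 1, fun r hr => ⟨?_, ?_⟩⟩
  · have hKr : 1 ≤ K * r := one_le_mul_of_one_le_of_one_le hK hr
    have hfin : {v : L | 0 < ℓ v ∧ ℓ v ≤ K * r}.Finite :=
      (hν.finite_setOf_le ((K * (K * r)) ^ c)).subset fun v hv =>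
        ((hcomp _ hKr v).2 hv.1 hv.2).2
    exact le_trans (Nat.cast_le.mpr (lieRFP_le_lieRFP P hfin fun v => (hcomp r hr v).1))
      (le_mul_of_one_le_left (Nat.cast_nonneg _) hK)
  · have hfin : {v : L | 0 < ν v ∧ ν v ≤ (K * r) ^ c}.Finite :=
      (hν.finite_setOf_le _).subset fun v hv => hv.2
    exact le_trans (Nat.cast_le.mpr (lieRFP_le_lieRFP P hfin fun v => (hcomp r hr v).2))
      (le_mul_of_one_le_left (Nat.cast_nonneg _) hK)
end

section
/- Let 𝔤 be a nonzero finite-dimensional Lie algebra over a field 𝔽. Then δ₁(𝔤,𝔽) = δ₂(𝔤,𝔽). -/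
noncomputable section

/-- `δ₁(𝔤,𝔽) = min{ max_i dim 𝔤/Iᵢ : I₁,…,I_k ideals with I₁ ∩ ⋯ ∩ I_k = 0 }`. -/
def delta1 (𝔽 : Type*) (𝔤 : Type*) [Field 𝔽] [LieRing 𝔤] [LieAlgebra 𝔽 𝔤] : ℕ :=
  sInf {d | ∃ (k : ℕ) (I : Fin k → LieIdeal 𝔽 𝔤), (⨅ i, I i) = ⊥ ∧
    d = Finset.univ.sup fun i => Module.finrank 𝔽 (𝔤 ⧸ I i)}

/-- `δ₂(𝔤,𝔽) = max{ min{ dim 𝔤/I : I ideal, v ∉ I } : 0 ≠ v ∈ 𝔤 }`. -/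
def delta2 (𝔽 : Type*) (𝔤 : Type*) [Field 𝔽] [LieRing 𝔤] [LieAlgebra 𝔽 𝔤] : ℕ :=
  sSup {d | ∃ v : 𝔤, v ≠ 0 ∧
    d = sInf {k | ∃ I : LieIdeal 𝔽 𝔤, v ∉ I ∧ Module.finrank 𝔽 (𝔤 ⧸ I) = k}}

end

/-- In a finite-dimensional Lie algebra, if every nonzero vector is avoided by an ideal with
property `P`, then finitely many ideals with property `P` intersect in zero. -/
theorem LieIdeal.exists_fin_iInf_eq_bot {𝔽 𝔤 : Type*} [Field 𝔽] [LieRing 𝔤] [LieAlgebra 𝔽 𝔤]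
    [FiniteDimensional 𝔽 𝔤] (P : LieIdeal 𝔽 𝔤 → Prop)
    (hP : ∀ v : 𝔤, v ≠ 0 → ∃ I : LieIdeal 𝔽 𝔤, v ∉ I ∧ P I) :
    ∃ (k : ℕ) (I : Fin k → LieIdeal 𝔽 𝔤), (⨅ i, I i) = ⊥ ∧ ∀ i, P (I i) := by
  let S : Set (LieIdeal 𝔽 𝔤) :=
    {J | ∃ (k : ℕ) (I : Fin k → LieIdeal 𝔽 𝔤), (⨅ i, I i) = J ∧ ∀ i, P (I i)}
  have hS : S.Nonempty := ⟨⨅ i : Fin 0, i.elim0, 0, fun i => i.elim0, rfl, fun i => i.elim0⟩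
  obtain ⟨J, ⟨k, I, rfl, hI⟩, hmin⟩ :=
    (LieSubmodule.wellFoundedLT_of_isArtinian 𝔽 𝔤 𝔤).wf.has_min S hS
  refine ⟨k, I, ?_, hI⟩
  by_contra hne
  rw [LieSubmodule.eq_bot_iff] at hne
  push Not at hne
  obtain ⟨v, hv, hv0⟩ := hne
  obtain ⟨I₀, hvI, hI₀⟩ := hP v hv0
  refine hmin (⨅ i, (Fin.cons I₀ I : Fin (k + 1) → LieIdeal 𝔽 𝔤) i)
    ⟨k + 1, Fin.cons I₀ I, rfl, Fin.cases hI₀ hI⟩ (lt_of_le_of_ne ?_ fun h => hvI ?_)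
  · exact le_iInf fun i => iInf_le_of_le i.succ le_rfl
  · rw [← h] at hv
    exact iInf_le (Fin.cons I₀ I : Fin (k + 1) → LieIdeal 𝔽 𝔤) 0 hv

/-- For a nonzero finite-dimensional Lie algebra `𝔤` over a field `𝔽`,
`δ₁(𝔤,𝔽) = δ₂(𝔤,𝔽)`. -/
theorem delta1_eq_delta2
    (𝔽 : Type*) (𝔤 : Type*) [Field 𝔽] [LieRing 𝔤] [LieAlgebra 𝔽 𝔤]
    [Nontrivial 𝔤] [FiniteDimensional 𝔽 𝔤] :
    delta1 𝔽 𝔤 = delta2 𝔽 𝔤 := by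
  apply le_antisymm
  · have hbdd : BddAbove {d | ∃ v : 𝔤, v ≠ 0 ∧
        d = sInf {k | ∃ I : LieIdeal 𝔽 𝔤, v ∉ I ∧ Module.finrank 𝔽 (𝔤 ⧸ I) = k}} := by
      refine ⟨Module.finrank 𝔽 (𝔤 ⧸ (⊥ : LieIdeal 𝔽 𝔤)), ?_⟩
      rintro d ⟨v, hv, rfl⟩
      exact Nat.sInf_le ⟨⊥, by simpa using hv, rfl⟩
    obtain ⟨k, I, hI, hle⟩ := LieIdeal.exists_fin_iInf_eq_bot
      (fun I : LieIdeal 𝔽 𝔤 => Module.finrank 𝔽 (𝔤 ⧸ I) ≤ delta2 𝔽 𝔤) fun v hv => by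
        have hne : {k | ∃ I : LieIdeal 𝔽 𝔤, v ∉ I ∧ Module.finrank 𝔽 (𝔤 ⧸ I) = k}.Nonempty :=
          ⟨_, ⊥, by simpa using hv, rfl⟩
        obtain ⟨I, hvI, hI⟩ := Nat.sInf_mem hne
        exact ⟨I, hvI, hI.trans_le (le_csSup hbdd ⟨v, hv, rfl⟩)⟩
    exact le_trans (Nat.sInf_le ⟨k, I, hI, rfl⟩) (Finset.sup_le fun i _ => hle i)
  · refine le_csInf ⟨_, 1, fun _ => ⊥, iInf_const, rfl⟩ ?_
    rintro d ⟨k, I, hI, rfl⟩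
    obtain ⟨w, hw⟩ := exists_ne (0 : 𝔤)
    refine csSup_le ⟨_, w, hw, rfl⟩ ?_
    rintro d ⟨v, hv, rfl⟩
    obtain ⟨i, hi⟩ : ∃ i, v ∉ I i := by
      by_contra! h
      have hmem : v ∈ ⨅ i, I i := (LieSubmodule.mem_iInf _).2 h
      rw [hI] at hmem
      exact hv (by simpa using hmem)
    exact le_trans (Nat.sInf_le ⟨I i, hi, rfl⟩)
      (Finset.le_sup (f := fun i => Module.finrank 𝔽 (𝔤 ⧸ I i)) (Finset.mem_univ i))
end

section
/- Let L be a Lie ring. For every k ∈ ℕ there exists M_k ∈ ℕ such that for every algebraically closed field 𝔽 of characteristic zero or of characteristic p > M_k, dim_𝔽 of the intersection of all ideals I of L^𝔽 with dim_𝔽 L^𝔽/I ≤ k equals dim_ℂ of the intersection of all ideals I of L^ℂ with dim_ℂ L^ℂ/I ≤ k. In particular, if L ≠ 0 there exists M_δ ∈ ℕ such that δ₂(L^𝔽, 𝔽) = δ₂(L^ℂ, ℂ) for every algebraically closed field 𝔽 of characteristic zero or of characteristic p > M_δ. -/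
open scoped TensorProduct

noncomputable section

/-- The `𝔽`-dimension of the intersection of all ideals `I` of `L^𝔽 = 𝔽 ⊗ L` with
`dim 𝔽 (L^𝔽/I) ≤ k`. -/
def interDimLE (𝔽 : Type*) [Field 𝔽] (L : Type*) [LieRing L] (k : ℕ) : ℕ :=
  Module.finrank 𝔽
    (LieSubmodule.toSubmodule
      (⨅ (I : LieIdeal 𝔽 (𝔽 ⊗[ℤ] L)) (_ : Module.finrank 𝔽 ((𝔽 ⊗[ℤ] L) ⧸ I) ≤ k), I))

/-- The `𝔽`-dimension of the intersection of all ideals `I` of `L^𝔽 = 𝔽 ⊗ L` with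
`dim 𝔽 (L^𝔽/I) < k`. -/
def interDimLT (𝔽 : Type*) [Field 𝔽] (L : Type*) [LieRing L] (k : ℕ) : ℕ :=
  Module.finrank 𝔽
    (LieSubmodule.toSubmodule
      (⨅ (I : LieIdeal 𝔽 (𝔽 ⊗[ℤ] L)) (_ : Module.finrank 𝔽 ((𝔽 ⊗[ℤ] L) ⧸ I) < k), I))

end

universe u

namespace LieLefschetz

open FirstOrder FirstOrder.Language FirstOrder.Ring FirstOrder.Field

/-- A first-order sentence in the language of rings has the same truth value in `ℂ` and in every
algebraically closed field of characteristic zero or of large positive characteristic. -/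
theorem exists_realize_iff_realize_complex [CompatibleRing ℂ] (φ : Language.ring.Sentence) :
    ∃ M : ℕ, ∀ (K : Type u) [Field K] [IsAlgClosed K] [CompatibleRing K],
      (ringChar K = 0 ∨ M < ringChar K) → (K ⊨ φ ↔ ℂ ⊨ φ) := by
  have key : ∀ ψ : Language.ring.Sentence, ℂ ⊨ ψ → ∃ M : ℕ,
      ∀ (K : Type u) [Field K] [IsAlgClosed K] [CompatibleRing K],
        (ringChar K = 0 ∨ M < ringChar K) → K ⊨ ψ := by
    intro ψ hψ
    have h0 : Theory.ACF 0 ⊨ᵇ ψ :=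
      ((ACF_isComplete (Or.inr rfl)).realize_sentence_iff ψ ℂ).1 hψ
    obtain ⟨M, hM⟩ :=
      ((ACF_zero_realize_iff_finite_ACF_prime_not_realize.1 h0).image
        ((↑) : Nat.Primes → ℕ)).bddAbove
    refine ⟨M, fun K _ _ _ hK => ?_⟩
    have hchar : CharP K (ringChar K) := inferInstance
    rcases CharP.char_is_prime_or_zero K (ringChar K) with hp | hp
    · have hlt : M < ringChar K := hK.resolve_left hp.ne_zero
      have : Theory.ACF (ringChar K) ⊨ᵇ ψ := by
        by_contra hn
        exact absurd (hM ⟨⟨ringChar K, hp⟩, hn, rfl⟩) (not_le.2 hlt)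
      exact this.realize_sentence K
    · rw [hp] at hchar
      exact h0.realize_sentence K
  by_cases h : ℂ ⊨ φ
  · obtain ⟨M, hM⟩ := key φ h
    exact ⟨M, fun K _ _ _ hK => iff_of_true (hM K hK) h⟩
  · obtain ⟨M, hM⟩ := key φ.not ((Sentence.realize_not ℂ).2 h)
    exact ⟨M, fun K _ _ _ hK => iff_of_false ((Sentence.realize_not K).1 (hM K hK)) h⟩

section Formulas

variable {α ι κ : Type} [Fintype ι] [Finite κ]

/-- The formula saying that the matrix `A` kills the vector `y`. -/
noncomputable def mulVecEqZero (A : κ → ι → FreeCommRing α) (y : ι → FreeCommRing α) :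
    Language.ring.Formula α :=
  Formula.iInf fun r => Term.equal (termOfFreeCommRing (∑ j, A r j * y j)) (termOfFreeCommRing 0)

/-- The formula saying that the vector `y` vanishes. -/
noncomputable def vecEqZero (y : ι → FreeCommRing α) : Language.ring.Formula α :=
  Formula.iInf fun j => Term.equal (termOfFreeCommRing (y j)) (termOfFreeCommRing 0)

variable {K : Type*} [CommRing K] [CompatibleRing K]

theorem realize_mulVecEqZero (A : κ → ι → FreeCommRing α) (y : ι → FreeCommRing α) (v : α → K) :
    (mulVecEqZero A y).Realize v ↔
      ∀ r, ∑ j, FreeCommRing.lift v (A r j) * FreeCommRing.lift v (y j) = 0 := by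
  simp [mulVecEqZero, Formula.realize_iInf, Formula.realize_equal]

theorem realize_vecEqZero (y : ι → FreeCommRing α) (v : α → K) :
    (vecEqZero y).Realize v ↔ ∀ j, FreeCommRing.lift v (y j) = 0 := by
  simp [vecEqZero, Formula.realize_iInf, Formula.realize_equal]

/-- The sentence saying that, in the algebra with structure constants `c`, the intersection of
the kernels of those linear maps to a `k`-dimensional space whose kernel is an ideal
has dimension at most `d`. -/
noncomputable def interDimLESentence (c : ι → ι → ι → ℤ) (k d : ℕ) : Language.ring.Sentence :=
  Formula.iExs (Fin d × ι) <| Formula.iAlls ι <|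
    (Formula.iAlls (Fin k × ι) <|
      (Formula.iAlls ι <|
        (mulVecEqZero (fun r j => .of (.inl (.inr (r, j)))) (fun j => .of (.inr j))).imp <|
        Formula.iInf fun i => mulVecEqZero (fun r j => .of (.inl (.inr (r, j))))
          (fun l => ∑ j, (c i j l : FreeCommRing _) * .of (.inr j))).imp <|
      mulVecEqZero (fun r j => .of (.inr (r, j))) (fun j => .of (.inl (.inr j)))).imp <|
    (mulVecEqZero (fun r j => .of (.inl (.inr (r, j)))) (fun j => .of (.inr j))).imp <|
    vecEqZero fun j => .of (.inr j)

theorem realize_interDimLESentence (c : ι → ι → ι → ℤ) (k d : ℕ) :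
    K ⊨ interDimLESentence c k d ↔
      ∃ D : Fin d × ι → K, ∀ v : ι → K,
        (∀ A : Fin k × ι → K,
          (∀ y : ι → K, (∀ r, ∑ j, A (r, j) * y j = 0) →
            ∀ i, ∀ r, ∑ l, A (r, l) * ∑ j, (c i j l : K) * y j = 0) →
          ∀ r, ∑ j, A (r, j) * v j = 0) →
        (∀ r, ∑ j, D (r, j) * v j = 0) → ∀ j, v j = 0 := by
  simp [interDimLESentence, Sentence.Realize, Formula.realize_iExs, Formula.realize_iAlls,
    Formula.realize_imp, Formula.realize_iInf, realize_mulVecEqZero, realize_vecEqZero]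

end Formulas

section LinearAlgebra

variable {K V : Type*} [Field K] [AddCommGroup V] [Module K V]

/-- Linear maps from a space with basis `b` to `κ → K`, given by their matrices. -/
noncomputable def matrixEquivLinearMap {ι κ : Type*} [Fintype ι] [Finite κ]
    (b : Module.Basis ι K V) : (κ × ι → K) ≃ (V →ₗ[K] (κ → K)) :=
  open Classical in
  (Equiv.curry κ ι K).trans (Matrix.toLin b (Pi.basisFun K κ)).toEquiv

theorem matrixEquivLinearMap_apply {ι κ : Type*} [Fintype ι] [Finite κ]
    (b : Module.Basis ι K V) (A : κ × ι → K) (v : V) (r : κ) :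
    matrixEquivLinearMap b A v r = ∑ j, A (r, j) * b.equivFun v j := by
  classical
  have h := Matrix.repr_toLin b (Pi.basisFun K κ) (Matrix.of (Function.curry A)) v
  exact congrFun h r

theorem finrank_le_iff_exists_linearMap [FiniteDimensional K V] (J : Submodule K V) (d : ℕ) :
    Module.finrank K J ≤ d ↔
      ∃ f : V →ₗ[K] (Fin d → K), ∀ v ∈ J, f v = 0 → v = 0 := by
  constructor
  · intro h
    obtain ⟨g, hg⟩ : ∃ g : J →ₗ[K] (Fin d → K), Function.Injective g :=
      _root_.finrank_le_iff_exists_linearMap.1 (by simpa using h)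
    obtain ⟨f, hf⟩ := g.exists_extend
    refine ⟨f, fun v hv hfv => ?_⟩
    have : g ⟨v, hv⟩ = 0 := by rw [← hf]; exact hfv
    simpa using (map_eq_zero_iff g hg).1 this
  · rintro ⟨f, hf⟩
    have hinj : Function.Injective (f ∘ₗ J.subtype) :=
      (injective_iff_map_eq_zero _).2 fun v hv => Subtype.ext (hf v v.2 hv)
    simpa using LinearMap.finrank_le_finrank_of_injective hinj

end LinearAlgebra

section Lie

variable {K V : Type*} [Field K] [LieRing V] [LieAlgebra K V] [FiniteDimensional K V]

theorem delta2_le_iff (k : ℕ) :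
    delta2 K V ≤ k ↔
      (⨅ (I : LieIdeal K V) (_ : Module.finrank K (V ⧸ I) ≤ k), I).toSubmodule = ⊥ := by
  have hne : ∀ v : V, v ≠ 0 →
      {k | ∃ I : LieIdeal K V, v ∉ I ∧ Module.finrank K (V ⧸ I) = k}.Nonempty := fun v hv =>
    ⟨_, ⊥, by simpa using hv, rfl⟩
  have hle : ∀ v : V, v ≠ 0 →
      (sInf {k | ∃ I : LieIdeal K V, v ∉ I ∧ Module.finrank K (V ⧸ I) = k} ≤ k ↔
        ∃ I : LieIdeal K V, Module.finrank K (V ⧸ I) ≤ k ∧ v ∉ I) := by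
    intro v hv
    constructor
    · intro h
      obtain ⟨I, hvI, hI⟩ := Nat.sInf_mem (hne v hv)
      exact ⟨I, hI.trans_le h, hvI⟩
    · rintro ⟨I, hI, hvI⟩
      refine (Nat.sInf_le ?_).trans hI
      exact ⟨I, hvI, rfl⟩
  have hbdd : BddAbove {d | ∃ v : V, v ≠ 0 ∧
      d = sInf {k | ∃ I : LieIdeal K V, v ∉ I ∧ Module.finrank K (V ⧸ I) = k}} := by
    refine ⟨Module.finrank K V, ?_⟩
    rintro _ ⟨v, hv, rfl⟩
    obtain ⟨I, -, hI⟩ := Nat.sInf_mem (hne v hv)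
    rw [← hI]
    exact Submodule.finrank_quotient_le I.toSubmodule
  rw [Submodule.eq_bot_iff]
  simp only [LieSubmodule.mem_toSubmodule, LieSubmodule.mem_iInf]
  constructor
  · intro h v hv
    by_contra hv0
    obtain ⟨I, hI, hvI⟩ := (hle v hv0).1 ((le_csSup hbdd ⟨v, hv0, rfl⟩).trans h)
    exact hvI (hv I hI)
  · intro h
    refine csSup_le' ?_
    rintro _ ⟨v, hv, rfl⟩
    rw [hle v hv]
    by_contra! hcon
    exact hv (h v hcon)

theorem mem_iInf_lieIdeal_iff {ι : Type*} (b : Module.Basis ι K V) (k : ℕ) (v : V) :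
    v ∈ (⨅ (I : LieIdeal K V) (_ : Module.finrank K (V ⧸ I) ≤ k), I) ↔
      ∀ f : V →ₗ[K] (Fin k → K), (∀ y, f y = 0 → ∀ i, f ⁅b i, y⁆ = 0) → f v = 0 := by
  simp only [LieSubmodule.mem_iInf]
  constructor
  · intro h f hf
    have hf' : ∀ x y : V, f y = 0 → f ⁅x, y⁆ = 0 := by
      intro x y hy
      have : f ∘ₗ (LieModule.toEnd K V V : V →ₗ[K] Module.End K V).flip y = 0 :=
        b.ext fun i => hf y hy i
      exact LinearMap.congr_fun this x
    let I : LieIdeal K V := { LinearMap.ker f with lie_mem := fun {x y} hy => hf' x y hy }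
    refine h I ?_
    calc Module.finrank K (V ⧸ I) = Module.finrank K (LinearMap.range f) :=
          f.quotKerEquivRange.finrank_eq
      _ ≤ k := by simpa using Submodule.finrank_le (LinearMap.range f)
  · intro h I hI
    obtain ⟨g, hg⟩ : ∃ g : (V ⧸ I) →ₗ[K] (Fin k → K), Function.Injective g :=
      _root_.finrank_le_iff_exists_linearMap.1 (by simpa using hI)
    have hker : ∀ y, (g ∘ₗ I.toSubmodule.mkQ) y = 0 ↔ y ∈ I := fun y => by
      rw [LinearMap.comp_apply]
      exact (map_eq_zero_iff g hg).trans (Submodule.Quotient.mk_eq_zero _)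
    refine (hker v).1 (h _ fun y hy i => ?_)
    exact (hker _).2 (I.lie_mem ((hker y).1 hy))

end Lie

section BaseChange

variable {L : Type} [LieRing L] {ι : Type} [Fintype ι]

theorem interDimLE_le_iff_realize (b : Module.Basis ι ℤ L) (K : Type*) [Field K] [CompatibleRing K]
    (k d : ℕ) :
    interDimLE K L k ≤ d ↔
      K ⊨ interDimLESentence (fun i j l => b.repr ⁅b i, b j⁆ l) k d := by
  let bK : Module.Basis ι K (K ⊗[ℤ] L) := Algebra.TensorProduct.basis K b
  have : FiniteDimensional K (K ⊗[ℤ] L) := bK.finiteDimensional_of_finite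
  have had : ∀ (y : K ⊗[ℤ] L) (i l : ι), bK.equivFun ⁅bK i, y⁆ l =
      ∑ j, ((b.repr ⁅b i, b j⁆ l : ℤ) : K) * bK.equivFun y j := by
    intro y i l
    have hbasis : ∀ j, bK.equivFun (LieAlgebra.ad K (K ⊗[ℤ] L) (bK i) (bK j)) l =
        ((b.repr ⁅b i, b j⁆ l : ℤ) : K) := fun j => by
      have h : LieAlgebra.ad K (K ⊗[ℤ] L) (bK i) (bK j) = (1 : K) ⊗ₜ[ℤ] ⁅b i, b j⁆ := by
        simp [bK, LieAlgebra.ExtendScalars.bracket_tmul]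
      rw [h]
      simp [bK]
    change bK.equivFun (LieAlgebra.ad K (K ⊗[ℤ] L) (bK i) y) l = _
    conv_lhs => rw [← bK.sum_equivFun y]
    simp only [map_sum, map_smul, Finset.sum_apply, Pi.smul_apply, smul_eq_mul, hbasis, mul_comm]
  rw [interDimLE, finrank_le_iff_exists_linearMap, realize_interDimLESentence]
  symm
  refine (matrixEquivLinearMap bK).exists_congr fun D => ?_
  refine bK.equivFun.symm.toEquiv.forall_congr fun v => ?_
  obtain ⟨v, rfl⟩ := bK.equivFun.surjective v
  rw [LieSubmodule.mem_toSubmodule, mem_iInf_lieIdeal_iff bK]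
  have hv : bK.equivFun.symm.toEquiv (bK.equivFun v) = v := bK.equivFun.symm_apply_apply v
  rw [hv]
  have hker : ∀ {κ : Type} [Finite κ] (A : κ × ι → K) (y : K ⊗[ℤ] L),
      matrixEquivLinearMap bK A y = 0 ↔ ∀ r, ∑ j, A (r, j) * bK.equivFun y j = 0 := by
    intro κ _ A y
    simp only [funext_iff, matrixEquivLinearMap_apply, Pi.zero_apply]
  refine imp_congr ((matrixEquivLinearMap bK).forall_congr fun A => imp_congr ?_ ?_)
    (imp_congr (hker D v).symm ?_)
  · refine bK.equivFun.symm.toEquiv.forall_congr fun y => ?_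
    obtain ⟨y, rfl⟩ := bK.equivFun.surjective y
    have hy : bK.equivFun.symm.toEquiv (bK.equivFun y) = y := bK.equivFun.symm_apply_apply y
    rw [hy, hker]
    simp only [hker, had]
  · exact (hker A v).symm
  · rw [← bK.equivFun.map_eq_zero_iff, funext_iff]
    rfl

theorem delta2_le_iff_realize (b : Module.Basis ι ℤ L) (K : Type*) [Field K] [CompatibleRing K]
    (k : ℕ) :
    delta2 K (K ⊗[ℤ] L) ≤ k ↔
      K ⊨ interDimLESentence (fun i j l => b.repr ⁅b i, b j⁆ l) k 0 := by
  have : FiniteDimensional K (K ⊗[ℤ] L) :=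
    (Algebra.TensorProduct.basis K b).finiteDimensional_of_finite
  rw [← interDimLE_le_iff_realize, delta2_le_iff, interDimLE, Nat.le_zero,
    Submodule.finrank_eq_zero]

end BaseChange

/-- An invariant of fields whose upper bounds are first-order expressible takes the same value
at `ℂ` and at every algebraically closed field of characteristic zero or of large positive
characteristic. -/
theorem exists_eq_of_le_iff_realize (x : ∀ (K : Type u) [Field K], ℕ) (c : ℕ)
    (φ : ℕ → Language.ring.Sentence)
    (hx : ∀ (K : Type u) [Field K] [CompatibleRing K] (d : ℕ), x K ≤ d ↔ K ⊨ φ d)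
    (hc : ∀ [CompatibleRing ℂ] (d : ℕ), c ≤ d ↔ ℂ ⊨ φ d) :
    ∃ M : ℕ, ∀ (K : Type u) (_ : Field K) (_ : IsAlgClosed K),
      (ringChar K = 0 ∨ M < ringChar K) → x K = c := by
  let _ := compatibleRingOfRing ℂ
  obtain ⟨M₁, h₁⟩ := exists_realize_iff_realize_complex (φ c)
  obtain ⟨M₂, h₂⟩ := exists_realize_iff_realize_complex (φ (c - 1))
  refine ⟨max M₁ M₂, fun K _ _ hK => ?_⟩
  let _ := compatibleRingOfRing K
  have h₁' := h₁ K (hK.imp_right (le_max_left M₁ M₂).trans_lt)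
  have h₂' := h₂ K (hK.imp_right (le_max_right M₁ M₂).trans_lt)
  rw [← hx, ← hc] at h₁' h₂'
  omega

end LieLefschetz

/-- For a Lie ring `L` and `k ∈ ℕ` there is `M_k` such that over every
algebraically closed field of characteristic zero or `p > M_k` the dimension of the
intersection of all ideals of `L^𝔽` of codimension `≤ k` equals the corresponding dimension
over `ℂ`; in particular if `L ≠ 0` there is `M_δ` beyond which `δ₂(L^𝔽,𝔽) = δ₂(L^ℂ,ℂ)`. -/
theorem interDim_eq_of_large_char
    (L : Type) [LieRing L] [Module.Free ℤ L] [Module.Finite ℤ L] :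
    (∀ k : ℕ, ∃ M : ℕ, ∀ (𝔽 : Type u) (_ : Field 𝔽) (_ : IsAlgClosed 𝔽),
      (ringChar 𝔽 = 0 ∨ M < ringChar 𝔽) →
        interDimLE 𝔽 L k = interDimLE ℂ L k) ∧
    (Nontrivial L → ∃ M : ℕ, ∀ (𝔽 : Type u) (_ : Field 𝔽) (_ : IsAlgClosed 𝔽),
      (ringChar 𝔽 = 0 ∨ M < ringChar 𝔽) →
        delta2 𝔽 (𝔽 ⊗[ℤ] L) = delta2 ℂ (ℂ ⊗[ℤ] L)) := by
  have b := Module.Free.chooseBasis ℤ L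
  exact ⟨fun k => LieLefschetz.exists_eq_of_le_iff_realize (fun K _ => interDimLE K L k) _ _
      (fun K _ _ d => LieLefschetz.interDimLE_le_iff_realize b K k d)
      (fun d => LieLefschetz.interDimLE_le_iff_realize b ℂ k d),
    fun _ => LieLefschetz.exists_eq_of_le_iff_realize (fun K _ => delta2 K (K ⊗[ℤ] L)) _ _
      (fun K _ _ k => LieLefschetz.delta2_le_iff_realize b K k)
      (fun k => LieLefschetz.delta2_le_iff_realize b ℂ k)⟩
end

section
/- Let L be a Lie ring and k ∈ ℕ. There exists a number field 𝔽 (a finite field extension of ℚ contained in ℂ) such that dim_𝔽 of the intersection of all ideals I of L^𝔽 with dim_𝔽 L^𝔽/I < k equals dim_ℂ of the intersection of all ideals I of L^ℂ with dim_ℂ L^ℂ/I < k. In particular, if L ≠ 0 there exists a number field 𝔽 with δ₂(L^ℂ, ℂ) = δ₂(L^𝔽, 𝔽). -/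
open scoped TensorProduct

open Matrix

/-- A nonzero finitely generated commutative `ℚ`-algebra maps to a number field. -/
theorem exists_ringHom_numberField (A : Type*) [CommRing A] [Nontrivial A] [Algebra ℚ A]
    [Algebra.FiniteType ℚ A] :
    ∃ F : IntermediateField ℚ ℂ, FiniteDimensional ℚ F ∧ Nonempty (A →+* F) := by
  obtain ⟨I, hI⟩ := Ideal.exists_maximal A
  let : Field (A ⧸ I) := Ideal.Quotient.field I
  have : Module.Finite ℚ (A ⧸ I) := finite_of_finite_type_of_isJacobsonRing ℚ (A ⧸ I)
  have : Module.IsTorsionFree ℚ (A ⧸ I) :=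
    Module.isTorsionFree_iff_faithfulSMul.2
      ((faithfulSMul_iff_algebraMap_injective ..).2 (algebraMap ℚ (A ⧸ I)).injective)
  let φ : (A ⧸ I) →ₐ[ℚ] ℂ := IsAlgClosed.lift
  refine ⟨φ.fieldRange, ?_, ⟨φ.rangeRestrict.toRingHom.comp (Ideal.Quotient.mk I)⟩⟩
  exact Module.Finite.range φ.toLinearMap

/-- Matrix data over `A` describing finitely many ideals of codimension `< k` in the extension of
scalars to `A` of the Lie ring with adjoint matrices `C`: the `j`-th ideal is the kernel of `M j`,
and `P`, `Q` witness that the intersection of these kernels has codimension at least `r`. -/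
structure IdealSystem (A : Type*) [CommRing A] {ι : Type*} [Fintype ι]
    (C : ι → Matrix ι ι ℤ) (k r : ℕ) where
  m : ℕ
  d : Fin m → ℕ
  d_lt : ∀ j, d j < k
  M : ∀ j, Matrix (Fin (d j)) ι A
  N : ∀ j, ι → Matrix (Fin (d j)) (Fin (d j)) A
  mul_eq : ∀ j i, M j * (C i).map (Int.castRingHom A) = N j i * M j
  P : ∀ j, Matrix (Fin r) (Fin (d j)) A
  Q : Matrix ι (Fin r) A
  sum_eq : (∑ j, P j * M j) * Q = 1

namespace IdealSystem

variable {A B : Type*} [CommRing A] [CommRing B] {ι : Type*} [Fintype ι]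
  {C : ι → Matrix ι ι ℤ} {k r : ℕ}

/-- The image of an ideal system under a ring homomorphism. -/
def map (f : A →+* B) (S : IdealSystem A C k r) : IdealSystem B C k r where
  m := S.m
  d := S.d
  d_lt := S.d_lt
  M j := (S.M j).map f
  N j i := (S.N j i).map f
  mul_eq j i := by
    have h := congrArg (fun X => X.map f) (S.mul_eq j i)
    have hf : (f : A → B) ∘ (Int.castRingHom A) = Int.castRingHom B := by ext; simp
    simpa only [Matrix.map_mul, Matrix.map_map, hf] using h
  P j := (S.P j).map f
  Q := S.Q.map f
  sum_eq := by
    have h := congrArg f.mapMatrix S.sum_eq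
    rw [map_one] at h
    rw [← h]
    ext a b
    simp [Matrix.mul_apply, Matrix.sum_apply]

/-- An ideal system is defined over a finitely generated subalgebra. -/
theorem exists_fg_subalgebra {R : Type*} [CommRing R] [Algebra R A] (S : IdealSystem A C k r) :
    ∃ A' : Subalgebra R A, A'.FG ∧ Nonempty (IdealSystem A' C k r) := by
  let s : Set A := (⋃ j, Set.range fun p : Fin (S.d j) × ι => S.M j p.1 p.2) ∪
    (⋃ j, Set.range fun p : ι × Fin (S.d j) × Fin (S.d j) => S.N j p.1 p.2.1 p.2.2) ∪
    (⋃ j, Set.range fun p : Fin r × Fin (S.d j) => S.P j p.1 p.2) ∪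
    Set.range fun p : ι × Fin r => S.Q p.1 p.2
  have hs : s.Finite := (((Set.finite_iUnion fun _ => Set.finite_range _).union
    (Set.finite_iUnion fun _ => Set.finite_range _)).union
    (Set.finite_iUnion fun _ => Set.finite_range _)).union (Set.finite_range _)
  have hM (j a b) : S.M j a b ∈ Algebra.adjoin R s :=
    Algebra.subset_adjoin (.inl (.inl (.inl (Set.mem_iUnion.2 ⟨j, (a, b), rfl⟩))))
  have hN (j i a b) : S.N j i a b ∈ Algebra.adjoin R s :=
    Algebra.subset_adjoin (.inl (.inl (.inr (Set.mem_iUnion.2 ⟨j, (i, a, b), rfl⟩))))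
  have hP (j a b) : S.P j a b ∈ Algebra.adjoin R s :=
    Algebra.subset_adjoin (.inl (.inr (Set.mem_iUnion.2 ⟨j, (a, b), rfl⟩)))
  have hQ (a b) : S.Q a b ∈ Algebra.adjoin R s := Algebra.subset_adjoin (.inr ⟨(a, b), rfl⟩)
  refine ⟨Algebra.adjoin R s, Subalgebra.fg_def.2 ⟨s, hs, rfl⟩, ⟨{
    m := S.m
    d := S.d
    d_lt := S.d_lt
    M := fun j => .of fun a b => ⟨S.M j a b, hM j a b⟩
    N := fun j i => .of fun a b => ⟨S.N j i a b, hN j i a b⟩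
    mul_eq := fun j i => ?_
    P := fun j => .of fun a b => ⟨S.P j a b, hP j a b⟩
    Q := .of fun a b => ⟨S.Q a b, hQ a b⟩
    sum_eq := ?_ }⟩⟩
  · ext a b
    simpa [Matrix.mul_apply] using congrFun (congrFun (S.mul_eq j i) a) b
  · ext a b
    have h := congrFun (congrFun S.sum_eq a) b
    simp only [Matrix.mul_apply, Matrix.sum_apply, Matrix.one_apply, Matrix.of_apply] at h ⊢
    push_cast
    rw [h]
    split_ifs <;> rfl

/-- An ideal system over `ℂ` yields one over some number field. -/
theorem exists_numberField (S : IdealSystem ℂ C k r) :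
    ∃ F : IntermediateField ℚ ℂ, FiniteDimensional ℚ F ∧ Nonempty (IdealSystem F C k r) := by
  obtain ⟨A', hA', ⟨S'⟩⟩ := S.exists_fg_subalgebra (R := ℚ)
  have : Algebra.FiniteType ℚ A' := A'.fg_iff_finiteType.1 hA'
  obtain ⟨F, hF, ⟨f⟩⟩ := exists_ringHom_numberField A'
  exact ⟨F, hF, ⟨S'.map f⟩⟩

end IdealSystem

section ExtendScalars

variable (K : Type*) [Field K] {L : Type*} [LieRing L] {ι : Type*} [Fintype ι] [DecidableEq ι]
  (b : Module.Basis ι ℤ L)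

/-- The matrices of the adjoint action of the basis vectors. -/
noncomputable def adMatrix (i : ι) : Matrix ι ι ℤ :=
  LinearMap.toMatrix b b (LieAlgebra.ad ℤ L (b i))

theorem toMatrix_ad_one_tmul (i : ι) :
    LinearMap.toMatrix (Algebra.TensorProduct.basis K b) (Algebra.TensorProduct.basis K b)
      (LieAlgebra.ad K (K ⊗[ℤ] L) ((1 : K) ⊗ₜ[ℤ] b i)) =
    (adMatrix b i).map (Int.castRingHom K) := by
  ext a c
  simp [LieAlgebra.ExtendScalars.bracket_tmul, adMatrix, LinearMap.toMatrix_apply]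

variable {K}

theorem mulVec_repr_lie {m : Type*} (M : Matrix m ι K) (N : ι → Matrix m m K) [Fintype m]
    (h : ∀ i, M * (adMatrix b i).map (Int.castRingHom K) = N i * M) (x y : K ⊗[ℤ] L)
    (hy : M *ᵥ (Algebra.TensorProduct.basis K b).repr y = 0) :
    M *ᵥ (Algebra.TensorProduct.basis K b).repr ⁅x, y⁆ = 0 := by
  have key (i : ι) : M *ᵥ (Algebra.TensorProduct.basis K b).repr ⁅(1 : K) ⊗ₜ[ℤ] b i, y⁆ = 0 := by
    have := LinearMap.toMatrix_mulVec_repr (Algebra.TensorProduct.basis K b)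
      (Algebra.TensorProduct.basis K b) (LieAlgebra.ad K (K ⊗[ℤ] L) ((1 : K) ⊗ₜ[ℤ] b i)) y
    rw [LieAlgebra.ad_apply, toMatrix_ad_one_tmul] at this
    rw [← this, Matrix.mulVec_mulVec, h, ← Matrix.mulVec_mulVec, hy, Matrix.mulVec_zero]
  change M *ᵥ (Algebra.TensorProduct.basis K b).repr (LieAlgebra.ad K (K ⊗[ℤ] L) x y) = 0
  rw [← (Algebra.TensorProduct.basis K b).sum_repr x]
  simp only [map_sum, map_smul, LinearMap.sum_apply, LinearMap.smul_apply, Finsupp.coe_finsetSum,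
    Finsupp.coe_smul, Matrix.mulVec_sum, Matrix.mulVec_smul, Algebra.TensorProduct.basis_apply,
    LieAlgebra.ad_apply, key, smul_zero, Finset.sum_const_zero]

/-- The ideal of `K ⊗ L` cut out by a matrix intertwining the adjoint action. -/
noncomputable def LieIdeal.ofMatrix {d : ℕ} (M : Matrix (Fin d) ι K)
    (N : ι → Matrix (Fin d) (Fin d) K)
    (h : ∀ i, M * (adMatrix b i).map (Int.castRingHom K) = N i * M) :
    LieIdeal K (K ⊗[ℤ] L) where
  __ := (Matrix.mulVecLin M ∘ₗ
    (Algebra.TensorProduct.basis K b).equivFun.toLinearMap).ker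
  lie_mem {x y} hy := mulVec_repr_lie b M N h x y hy

theorem LieIdeal.mem_ofMatrix {d : ℕ} {M : Matrix (Fin d) ι K}
    {N : ι → Matrix (Fin d) (Fin d) K}
    {h : ∀ i, M * (adMatrix b i).map (Int.castRingHom K) = N i * M} {x : K ⊗[ℤ] L} :
    x ∈ LieIdeal.ofMatrix b M N h ↔ M *ᵥ (Algebra.TensorProduct.basis K b).repr x = 0 :=
  Iff.rfl

theorem LieIdeal.finrank_quotient_ofMatrix_le {d : ℕ} (M : Matrix (Fin d) ι K)
    (N : ι → Matrix (Fin d) (Fin d) K)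
    (h : ∀ i, M * (adMatrix b i).map (Int.castRingHom K) = N i * M) :
    Module.finrank K ((K ⊗[ℤ] L) ⧸ LieIdeal.ofMatrix b M N h) ≤ d := by
  let T := Matrix.mulVecLin M ∘ₗ (Algebra.TensorProduct.basis K b).equivFun.toLinearMap
  have e : ((K ⊗[ℤ] L) ⧸ LieIdeal.ofMatrix b M N h) ≃ₗ[K] T.range := T.quotKerEquivRange
  rw [e.finrank_eq]
  simpa using T.range.finrank_le

/-- Every ideal of `K ⊗ L` is cut out by a matrix intertwining the adjoint action. -/
theorem LieIdeal.exists_matrix (I : LieIdeal K (K ⊗[ℤ] L)) :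
    ∃ (M : Matrix (Fin (Module.finrank K ((K ⊗[ℤ] L) ⧸ I))) ι K)
      (N : ι → Matrix (Fin (Module.finrank K ((K ⊗[ℤ] L) ⧸ I)))
        (Fin (Module.finrank K ((K ⊗[ℤ] L) ⧸ I))) K),
      (∀ i, M * (adMatrix b i).map (Int.castRingHom K) = N i * M) ∧
      ∀ x, M *ᵥ (Algebra.TensorProduct.basis K b).repr x = 0 ↔ x ∈ I := by
  have : Module.Finite K (K ⊗[ℤ] L) := .of_basis (Algebra.TensorProduct.basis K b)
  have : Module.Finite K ((K ⊗[ℤ] L) ⧸ I) :=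
    inferInstanceAs (Module.Finite K ((K ⊗[ℤ] L) ⧸ I.toSubmodule))
  let c := Module.finBasis K ((K ⊗[ℤ] L) ⧸ I)
  refine ⟨LinearMap.toMatrix (Algebra.TensorProduct.basis K b) c (LieSubmodule.Quotient.mk' I),
    fun i => LinearMap.toMatrix c c
      (LieModule.toEnd K (K ⊗[ℤ] L) ((K ⊗[ℤ] L) ⧸ I) ((1 : K) ⊗ₜ[ℤ] b i)), fun i => ?_,
    fun x => ?_⟩
  · rw [← toMatrix_ad_one_tmul, ← LinearMap.toMatrix_comp, ← LinearMap.toMatrix_comp]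
    rfl
  · rw [LinearMap.toMatrix_mulVec_repr]
    simp

/-- An ideal system over `K` bounds the intersection of the ideals of small codimension. -/
theorem IdealSystem.interDimLT_add_le {k r : ℕ} (S : IdealSystem K (adMatrix b) k r) :
    interDimLT K L k + r ≤ Fintype.card ι := by
  have : Module.Finite K (K ⊗[ℤ] L) := .of_basis (Algebra.TensorProduct.basis K b)
  let T : (K ⊗[ℤ] L) →ₗ[K] (Fin r → K) := Matrix.mulVecLin (∑ j, S.P j * S.M j) ∘ₗ
    (Algebra.TensorProduct.basis K b).equivFun.toLinearMap
  have hT : Function.Surjective T := by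
    intro v
    refine ⟨(Algebra.TensorProduct.basis K b).equivFun.symm (S.Q *ᵥ v), ?_⟩
    simp only [T, LinearMap.comp_apply, LinearEquiv.coe_coe, LinearEquiv.apply_symm_apply,
      Matrix.mulVecLin_apply, Matrix.mulVec_mulVec, S.sum_eq, Matrix.one_mulVec]
  have hker : LieSubmodule.toSubmodule (⨅ (I : LieIdeal K (K ⊗[ℤ] L))
      (_ : Module.finrank K ((K ⊗[ℤ] L) ⧸ I) < k), I) ≤ T.ker := by
    intro x hx
    have hx' (j) : S.M j *ᵥ (Algebra.TensorProduct.basis K b).repr x = 0 :=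
      (LieIdeal.mem_ofMatrix b (h := S.mul_eq j)).1 <|
        iInf₂_le (α := LieIdeal K (K ⊗[ℤ] L)) (LieIdeal.ofMatrix b (S.M j) (S.N j) (S.mul_eq j))
          ((LieIdeal.finrank_quotient_ofMatrix_le b _ _ _).trans_lt (S.d_lt j)) hx
    change (∑ j, S.P j * S.M j) *ᵥ (Algebra.TensorProduct.basis K b).repr x = 0
    simp only [Matrix.sum_mulVec, ← Matrix.mulVec_mulVec, hx', Matrix.mulVec_zero,
      Finset.sum_const_zero]
  have h1 := Submodule.finrank_mono hker
  have h2 := T.finrank_range_add_finrank_ker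
  rw [LinearMap.range_eq_top.2 hT, finrank_top, Module.finrank_fin_fun,
    Module.finrank_eq_card_basis (Algebra.TensorProduct.basis K b)] at h2
  unfold interDimLT
  omega

/-- The intersection of the ideals of small codimension is computed by an ideal system. -/
theorem IdealSystem.exists_interDimLT_add_eq (k : ℕ) :
    ∃ r, interDimLT K L k + r = Fintype.card ι ∧
      Nonempty (IdealSystem K (adMatrix b) k r) := by
  have : Module.Finite K (K ⊗[ℤ] L) := .of_basis (Algebra.TensorProduct.basis K b)
  obtain ⟨r, hr⟩ : ∃ r, interDimLT K L k + r = Fintype.card ι := by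
    rw [← Module.finrank_eq_card_basis (Algebra.TensorProduct.basis K b)]
    exact Nat.le.dest (Submodule.finrank_le _)
  have := LieSubmodule.wellFoundedLT_of_isArtinian K (K ⊗[ℤ] L) (K ⊗[ℤ] L)
  let s : Set (LieIdeal K (K ⊗[ℤ] L)) := {I | Module.finrank K ((K ⊗[ℤ] L) ⧸ I) < k}
  obtain ⟨t, hts, ht⟩ : ∃ t : Finset (LieIdeal K (K ⊗[ℤ] L)),
      (t : Set (LieIdeal K (K ⊗[ℤ] L))) ⊆ s ∧ sInf s = t.inf id :=
    CompleteLattice.WellFoundedGT.isSupFiniteCompact (α := (LieIdeal K (K ⊗[ℤ] L))ᵒᵈ) s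
  let I (j : Fin t.card) : LieIdeal K (K ⊗[ℤ] L) := (t.equivFin.symm j : LieIdeal K (K ⊗[ℤ] L))
  choose M N hMN hM using fun j => LieIdeal.exists_matrix b (I j)
  let T : (ι → K) →ₗ[K] ∀ j, Fin (Module.finrank K ((K ⊗[ℤ] L) ⧸ I j)) → K :=
    LinearMap.pi fun j => Matrix.mulVecLin (M j)
  let V := LieSubmodule.toSubmodule (⨅ (I : LieIdeal K (K ⊗[ℤ] L))
      (_ : Module.finrank K ((K ⊗[ℤ] L) ⧸ I) < k), I)
  have hV : (T ∘ₗ (Algebra.TensorProduct.basis K b).equivFun.toLinearMap).ker = V := by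
    ext x
    have h1 : x ∈ V ↔ ∀ J ∈ t, x ∈ J := by
      change x ∈ (⨅ J ∈ s, J) ↔ _
      rw [← sInf_eq_iInf, ht, Finset.inf_eq_iInf]
      simp [LieSubmodule.mem_iInf]
    rw [h1, LinearMap.mem_ker, funext_iff]
    change (∀ j, M j *ᵥ (Algebra.TensorProduct.basis K b).repr x = 0) ↔ _
    simp only [hM, I]
    rw [t.equivFin.symm.forall_congr_left]
    simp
  have hrank : Module.finrank K T.range = r := by
    have h2 := (T ∘ₗ
      (Algebra.TensorProduct.basis K b).equivFun.toLinearMap).finrank_range_add_finrank_ker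
    rw [hV, LinearMap.range_comp_of_range_eq_top _ (LinearEquiv.range _),
      Module.finrank_eq_card_basis (Algebra.TensorProduct.basis K b)] at h2
    change Module.finrank K V + r = _ at hr
    omega
  let e : T.range ≃ₗ[K] (Fin r → K) := LinearEquiv.ofFinrankEq _ _ (by simp [hrank])
  obtain ⟨q, hq⟩ := T.rangeRestrict.exists_rightInverse_of_surjective T.range_rangeRestrict
  obtain ⟨p, hp⟩ := T.range.subtype.exists_leftInverse_of_injective T.range.ker_subtype
  let P := e.toLinearMap ∘ₗ p
  let Q := q ∘ₗ e.symm.toLinearMap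
  have hPQ (v) : P (T (Q v)) = v := by
    have h1 := LinearMap.congr_fun hq (e.symm v)
    have h2 := LinearMap.congr_fun hp (T.rangeRestrict (q (e.symm v)))
    simp only [LinearMap.comp_apply, LinearMap.id_apply] at h1 h2
    change e (p (T (q (e.symm v)))) = v
    rw [h1] at h2
    have h3 : T (q (e.symm v)) = T.range.subtype (e.symm v) := congrArg Subtype.val h1
    rw [h3, h2, e.apply_symm_apply]
  refine ⟨r, hr, ⟨{
    m := t.card
    d := fun j => Module.finrank K ((K ⊗[ℤ] L) ⧸ I j)
    d_lt := fun j => hts (t.equivFin.symm j).2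
    M := M
    N := N
    mul_eq := hMN
    P := fun j => LinearMap.toMatrix' (P ∘ₗ LinearMap.single K
      (fun j => Fin (Module.finrank K ((K ⊗[ℤ] L) ⧸ I j)) → K) j)
    Q := LinearMap.toMatrix' Q
    sum_eq := ?_ }⟩⟩
  refine Matrix.ext_of_mulVec_single fun i => ?_
  rw [← Matrix.mulVec_mulVec, LinearMap.toMatrix'_mulVec, Matrix.one_mulVec, Matrix.sum_mulVec]
  simp only [← Matrix.mulVec_mulVec, LinearMap.toMatrix'_mulVec, LinearMap.comp_apply]
  rw [← map_sum]
  conv_rhs => rw [← hPQ (Pi.single i 1)]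
  congr 1
  exact Finset.univ_sum_single (T (Q (Pi.single i 1)))

end ExtendScalars

section NumberField

variable {L : Type*} [LieRing L] [Module.Free ℤ L] [Module.Finite ℤ L]

theorem interDimLT_le_of_ringHom {K K' : Type*} [Field K] [Field K'] (f : K →+* K') (k : ℕ) :
    interDimLT K' L k ≤ interDimLT K L k := by
  classical
  let b := Module.Free.chooseBasis ℤ L
  obtain ⟨r, hr, ⟨S⟩⟩ := IdealSystem.exists_interDimLT_add_eq (K := K) b k
  have := (S.map f).interDimLT_add_le
  omega

variable (L) in
theorem exists_numberField_interDimLT_eq (k : ℕ) :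
    ∃ F : IntermediateField ℚ ℂ, FiniteDimensional ℚ F ∧
      interDimLT F L k = interDimLT ℂ L k := by
  classical
  let b := Module.Free.chooseBasis ℤ L
  obtain ⟨r, hr, ⟨S⟩⟩ := IdealSystem.exists_interDimLT_add_eq (K := ℂ) b k
  obtain ⟨F, hF, ⟨S'⟩⟩ := S.exists_numberField
  refine ⟨F, hF, le_antisymm ?_ (interDimLT_le_of_ringHom (algebraMap F ℂ) k)⟩
  have := S'.interDimLT_add_le
  omega

theorem delta2_lt_iff (K : Type*) [Field K] [Nontrivial L] (k : ℕ) :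
    delta2 K (K ⊗[ℤ] L) < k ↔ interDimLT K L k = 0 := by
  classical
  let b := Module.Free.chooseBasis ℤ L
  have hfin : Module.Finite K (K ⊗[ℤ] L) := .of_basis (Algebra.TensorProduct.basis K b)
  obtain ⟨i⟩ := b.index_nonempty
  have hnt : Nontrivial (K ⊗[ℤ] L) :=
    nontrivial_of_ne _ _ ((Algebra.TensorProduct.basis K b).ne_zero i)
  let D (v : K ⊗[ℤ] L) : Set ℕ :=
    {d | ∃ I : LieIdeal K (K ⊗[ℤ] L), v ∉ I ∧ Module.finrank K ((K ⊗[ℤ] L) ⧸ I) = d}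
  have hD (v : K ⊗[ℤ] L) (hv : v ≠ 0) : (D v).Nonempty := ⟨_, ⊥, by simpa using hv, rfl⟩
  let E : Set ℕ := {d | ∃ v : K ⊗[ℤ] L, v ≠ 0 ∧ d = sInf (D v)}
  have hE : E.Nonempty :=
    (exists_ne (0 : K ⊗[ℤ] L)).elim fun v hv => ⟨_, v, hv, rfl⟩
  have hEb : BddAbove E := by
    refine ⟨Module.finrank K (K ⊗[ℤ] L), ?_⟩
    rintro _ ⟨v, hv, rfl⟩
    obtain ⟨I, -, hI⟩ := Nat.sInf_mem (hD v hv)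
    rw [← hI]
    exact Submodule.finrank_quotient_le I.toSubmodule
  have h1 : delta2 K (K ⊗[ℤ] L) < k ↔ ∀ d ∈ E, d < k :=
    ⟨fun h d hd => (le_csSup hEb hd).trans_lt h, fun h => h _ (Nat.sSup_mem hE hEb)⟩
  rw [h1, interDimLT, Submodule.finrank_eq_zero, Submodule.eq_bot_iff]
  simp only [LieSubmodule.mem_toSubmodule, LieSubmodule.mem_iInf]
  constructor
  · intro h v hv
    by_contra hv0
    obtain ⟨I, hvI, hI⟩ := Nat.sInf_mem (hD v hv0)
    exact hvI (hv I (hI ▸ h _ ⟨v, hv0, rfl⟩))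
  · rintro h _ ⟨v, hv, rfl⟩
    by_contra hk
    exact hv <| h v fun I hI => by_contra fun hvI =>
      hk ((Nat.sInf_le (s := D v) ⟨I, hvI, rfl⟩).trans_lt hI)

end NumberField

/-- For a Lie ring `L` and `k ∈ ℕ` there is a number field `𝔽 ⊆ ℂ`
(a finite extension of `ℚ` inside `ℂ`) over which the dimension of the intersection of all
ideals of `L^𝔽` of codimension `< k` equals the corresponding dimension over `ℂ`;
in particular, if `L ≠ 0` there is a number field `𝔽` with `δ₂(L^ℂ,ℂ) = δ₂(L^𝔽,𝔽)`. -/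
theorem interDim_eq_of_number_field
    (L : Type*) [LieRing L] [Module.Free ℤ L] [Module.Finite ℤ L] (k : ℕ) :
    (∃ 𝔽 : IntermediateField ℚ ℂ, FiniteDimensional ℚ 𝔽 ∧
      interDimLT 𝔽 L k = interDimLT ℂ L k) ∧
    (Nontrivial L → ∃ 𝔽 : IntermediateField ℚ ℂ, FiniteDimensional ℚ 𝔽 ∧
      delta2 ℂ (ℂ ⊗[ℤ] L) = delta2 𝔽 (𝔽 ⊗[ℤ] L)) := by
  refine ⟨exists_numberField_interDimLT_eq L k, fun _ => ?_⟩
  obtain ⟨F, hF, h⟩ := exists_numberField_interDimLT_eq L (delta2 ℂ (ℂ ⊗[ℤ] L) + 1)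
  have hC := (delta2_lt_iff (L := L) ℂ _).1 (Nat.lt_succ_self _)
  refine ⟨F, hF, le_antisymm ?_ (Nat.lt_succ_iff.1 ((delta2_lt_iff F _).2 (h.trans hC)))⟩
  refine Nat.lt_succ_iff.1 ((delta2_lt_iff ℂ _).2 (Nat.le_zero.1 ?_))
  exact (interDimLT_le_of_ringHom (algebraMap F ℂ) _).trans
    ((delta2_lt_iff F _).1 (Nat.lt_succ_self _)).le
end

section
/- Let L be a nonzero Lie ring and set δ = δ₂(L^ℂ, ℂ). There exist an ideal I_δ of L and M ∈ ℕ such that for every algebraically closed field 𝔽 of characteristic zero or of characteristic p > M, the 𝔽-linear span of the image of I_δ under the canonical map L → L^𝔽 (v ↦ v ⊗ 1) equals the intersection of all ideals I of L^𝔽 with dim_𝔽 L^𝔽/I < δ. -/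
open scoped TensorProduct

universe u

open FirstOrder FirstOrder.Language FirstOrder.Ring

/-- Galois descent for subspaces: a subspace of `K^ι` stable under the Galois group of `K/k` is
spanned by its `k`-rational vectors. -/
theorem Submodule.eq_span_rational_of_galois_stable {k K ι : Type*} [Field k] [Field K]
    [Algebra k K] [IsGalois k K] [Finite ι] (W : Submodule K (ι → K))
    (hW : ∀ (σ : Gal(K/k)), ∀ v ∈ W, (fun i => σ (v i)) ∈ W) :
    W = Submodule.span K {v | v ∈ W ∧ ∃ w : ι → k, v = fun i => algebraMap k K (w i)} := by
  refine le_antisymm ?_ (Submodule.span_le.2 fun v hv => hv.1)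
  intro v
  induction hs : (Function.support v).ncard using Nat.strong_induction_on generalizing v with
  | _ n ih =>
  intro hv
  by_cases hv0 : v = 0
  · rw [hv0]
    exact zero_mem _
  by_cases hmin : ∃ u ∈ W, u ≠ 0 ∧ Function.support u ⊂ Function.support v
  · obtain ⟨u, hu, hu0, hsub⟩ := hmin
    obtain ⟨i, hi⟩ := Function.ne_iff.1 hu0
    have hlt : (Function.support u).ncard < n := hs ▸ Set.ncard_lt_ncard hsub (Set.toFinite _)
    have hu' := ih _ hlt rfl hu
    have hsub' : Function.support (v - (v i / u i) • u) ⊂ Function.support v := by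
      refine (Set.ssubset_iff_of_subset ?_).2 ⟨i, hsub.1 hi, ?_⟩
      · intro j hj hvj
        have huj : u j = 0 := by
          by_contra h
          exact hsub.1 h hvj
        exact hj (by simp [hvj, huj])
      · have : u i ≠ 0 := hi
        simp [this]
    have := ih _ (hs ▸ Set.ncard_lt_ncard hsub' (Set.toFinite _)) rfl
      (W.sub_mem hv (W.smul_mem _ hu))
    simpa using Submodule.add_mem _ this (Submodule.smul_mem _ (v i / u i) hu')
  · push Not at hmin
    obtain ⟨i, hi⟩ := Function.ne_iff.1 hv0
    have hi : v i ≠ 0 := hi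
    have hw : (v i)⁻¹ • v ∈ W := W.smul_mem _ hv
    have hfix : ∀ σ : Gal(K/k), ∀ j, σ ((v i)⁻¹ * v j) = (v i)⁻¹ * v j := by
      intro σ j
      by_contra hne
      refine hmin _ (W.sub_mem (hW σ _ hw) hw) ?_ ?_
      · exact Function.ne_iff.2 ⟨j, by simpa [sub_eq_zero] using hne⟩
      · refine (Set.ssubset_iff_of_subset ?_).2 ⟨i, hi, ?_⟩
        · intro l hl hvl
          exact hl (by simp [hvl])
        · simp [hi]
    have hr : ∀ j, ∃ x : k, algebraMap k K x = (v i)⁻¹ * v j := fun j =>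
      (InfiniteGalois.mem_range_algebraMap_iff_fixed _).2 fun σ => hfix σ j
    choose w hw' using hr
    have hmem := Submodule.subset_span (R := K)
      (s := {v | v ∈ W ∧ ∃ w : ι → k, v = fun i => algebraMap k K (w i)})
      ⟨hw, w, funext fun j => (hw' j).symm⟩
    simpa [smul_smul, hi] using Submodule.smul_mem _ (v i) hmem

/-- A family of predicates on tuples of field elements that is cut out, over all fields of a
universe at once, by one first-order formula in the language of rings. -/
def UniformlyDefinable {α : Type} (P : ∀ (F : Type u) [Field F], (α → F) → Prop) : Prop :=
  ∃ φ : ring.Formula α, ∀ (F : Type u) [Field F] [CompatibleRing F] (v : α → F),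
    φ.Realize v ↔ P F v

namespace UniformlyDefinable

variable {α β : Type}

theorem lift_eq_zero (p : FreeCommRing α) :
    UniformlyDefinable.{u} fun F _ v => FreeCommRing.lift v p = (0 : F) :=
  ⟨(termOfFreeCommRing p).equal 0, fun F _ _ v => by simp [Formula.realize_equal]⟩

theorem imp {P Q : ∀ (F : Type u) [Field F], (α → F) → Prop} (hP : UniformlyDefinable P)
    (hQ : UniformlyDefinable Q) : UniformlyDefinable fun F _ v => P F v → Q F v := by
  obtain ⟨φ, hφ⟩ := hP
  obtain ⟨ψ, hψ⟩ := hQ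
  exact ⟨φ.imp ψ, fun F _ _ v => by rw [Formula.realize_imp, hφ, hψ]⟩

theorem iff {P Q : ∀ (F : Type u) [Field F], (α → F) → Prop} (hP : UniformlyDefinable P)
    (hQ : UniformlyDefinable Q) : UniformlyDefinable fun F _ v => (P F v ↔ Q F v) := by
  obtain ⟨φ, hφ⟩ := hP
  obtain ⟨ψ, hψ⟩ := hQ
  exact ⟨φ.iff ψ, fun F _ _ v => by rw [Formula.realize_iff, hφ, hψ]⟩

theorem forall_index [Finite β] {P : β → ∀ (F : Type u) [Field F], (α → F) → Prop}
    (hP : ∀ b, UniformlyDefinable (P b)) : UniformlyDefinable fun F _ v => ∀ b, P b F v := by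
  choose φ hφ using hP
  exact ⟨Formula.iInf φ, fun F _ _ v => by simp only [Formula.realize_iInf, hφ]⟩

theorem forall_tuple [Finite β] {P : ∀ (F : Type u) [Field F], (α → F) → (β → F) → Prop}
    (hP : UniformlyDefinable fun F _ (u : α ⊕ β → F) => P F (u ∘ Sum.inl) (u ∘ Sum.inr)) :
    UniformlyDefinable fun F _ v => ∀ w, P F v w := by
  obtain ⟨φ, hφ⟩ := hP
  refine ⟨φ.iAlls β, fun F _ _ v => ?_⟩
  simp only [Formula.realize_iAlls, hφ]
  exact Iff.rfl

theorem exists_tuple [Finite β] {P : ∀ (F : Type u) [Field F], (α → F) → (β → F) → Prop}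
    (hP : UniformlyDefinable fun F _ (u : α ⊕ β → F) => P F (u ∘ Sum.inl) (u ∘ Sum.inr)) :
    UniformlyDefinable fun F _ v => ∃ w, P F v w := by
  obtain ⟨φ, hφ⟩ := hP
  refine ⟨φ.iExs β, fun F _ _ v => ?_⟩
  simp only [Formula.realize_iExs, hφ]
  exact Iff.rfl

/-- Uniformly definable predicates are invariant under field automorphisms. -/
theorem comp_ringEquiv {P : ∀ (F : Type u) [Field F], (α → F) → Prop} (hP : UniformlyDefinable P)
    {F : Type u} [Field F] (σ : F ≃+* F) (v : α → F) : P F (fun i => σ (v i)) ↔ P F v := by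
  obtain ⟨φ, hφ⟩ := hP
  let _ := compatibleRingOfRing F
  rw [← hφ, ← hφ]
  exact StrongHomClass.realize_formula (languageEquivEquivRingEquiv.symm σ) φ

/-- **Lefschetz principle** for uniformly definable predicates without free variables. -/
theorem lefschetz {P : ∀ (F : Type u) [Field F], (Empty → F) → Prop} (hP : UniformlyDefinable P)
    (K : Type u) [Field K] [IsAlgClosed K] [CharZero K] (hK : P K Empty.elim) :
    ∃ M : ℕ, ∀ (F : Type u) (_ : Field F) (_ : IsAlgClosed F),
      (ringChar F = 0 ∨ M < ringChar F) → P F Empty.elim := by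
  obtain ⟨φ, hφ⟩ := hP
  have hφ' (F : Type u) [Field F] [CompatibleRing F] : F ⊨ φ ↔ P F Empty.elim := by
    rw [← hφ F, Sentence.Realize, Subsingleton.elim (default : Empty → F) Empty.elim]
  have h0 : Theory.ACF 0 ⊨ᵇ φ := by
    let _ := compatibleRingOfRing K
    exact ((Field.ACF_isComplete (Or.inr rfl)).realize_sentence_iff φ K).1 ((hφ' K).2 hK)
  have hfin := Field.finite_ACF_prime_not_realize_of_ACF_zero_realize φ h0
  obtain ⟨M, hM⟩ := (hfin.image fun p : Nat.Primes => (p : ℕ)).bddAbove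
  refine ⟨M, fun F _ _ hF => ?_⟩
  let _ := compatibleRingOfRing F
  have hchar := ringChar.charP F
  rw [← hφ' F]
  rcases CharP.char_is_prime_or_zero F (ringChar F) with hp | hp
  · refine Theory.ModelsBoundedFormula.realize_sentence (T := Theory.ACF (ringChar F)) ?_ F
    have hlt : M < ringChar F := hF.resolve_left hp.ne_zero
    by_contra hn
    exact hlt.not_ge (hM ⟨⟨ringChar F, hp⟩, hn, rfl⟩)
  · rw [hp] at hchar
    exact h0.realize_sentence F

end UniformlyDefinable

/-- Casting integer vectors into a field. -/
def intVecCast (F ι : Type*) [Field F] : (ι → ℤ) →ₗ[ℤ] (ι → F) where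
  toFun w i := w i
  map_add' w w' := by ext; simp
  map_smul' c w := by ext; simp

/-- A uniformly definable family of subspaces is spanned by a fixed lattice of integer vectors over
all algebraically closed fields of characteristic zero or large positive characteristic. -/
theorem exists_forall_eq_span_intVecCast {ι : Type} [Finite ι]
    (S : ∀ (F : Type u) [Field F], Submodule F (ι → F))
    (hS : UniformlyDefinable.{u} fun F _ v => v ∈ S F) (K : Type u) [Field K]
    [Algebra (ULift.{u} ℚ) K] [IsAlgClosure (ULift.{u} ℚ) K] :
    ∃ M : ℕ, ∀ (F : Type u) (_ : Field F) (_ : IsAlgClosed F),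
      (ringChar F = 0 ∨ M < ringChar F) →
        S F = Submodule.span F (intVecCast F ι '' {w | intVecCast K ι w ∈ S K}) := by
  have := IsAlgClosure.isAlgClosed (ULift.{u} ℚ) (K := K)
  have : CharZero (ULift.{u} ℚ) := CharP.charP_to_charZero _
  have : CharZero K := charZero_of_injective_algebraMap (algebraMap (ULift.{u} ℚ) K).injective
  have : IsGalois (ULift.{u} ℚ) K :=
    { to_isSeparable := inferInstance
      to_normal := IsAlgClosure.normal _ _ }
  let N : Submodule ℤ (ι → ℤ) := ((S K).restrictScalars ℤ).comap (intVecCast K ι)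
  obtain ⟨s, hs⟩ := IsNoetherian.noetherian N
  have hspan (F : Type u) [Field F] :
      Submodule.span F (intVecCast F ι '' {w | intVecCast K ι w ∈ S K}) =
        Submodule.span F (Set.range fun w : s => intVecCast F ι w) := by
    have hN : {w | intVecCast K ι w ∈ S K} = (Submodule.span ℤ (s : Set (ι → ℤ)) : Set _) := by
      rw [hs]
      rfl
    rw [hN, ← Submodule.map_coe, Submodule.map_span, Submodule.span_span_of_tower]
    congr 1
    ext
    simp
  have hdef : UniformlyDefinable.{u} fun F _ (_ : Empty → F) => ∀ v : ι → F,
      (v ∈ S F ↔ ∃ c : s → F, ∀ i, v i - ∑ j, c j * (((j : ι → ℤ) i : ℤ) : F) = 0) := by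
    refine .forall_tuple (.iff ?_ (.exists_tuple (.forall_index fun i => ?_)))
    · obtain ⟨φ, hφ⟩ := hS
      exact ⟨φ.relabel Sum.inr, fun F _ _ v => by rw [Formula.realize_relabel, hφ]⟩
    · have := UniformlyDefinable.lift_eq_zero.{u} (α := (Empty ⊕ ι) ⊕ s) (.of (.inl (.inr i)) -
        ∑ j : s, .of (.inr j) * (((j : ι → ℤ) i : ℤ) : FreeCommRing ((Empty ⊕ ι) ⊕ s)))
      simpa using this
  have hmem (F : Type u) [Field F] (v : ι → F) :
      v ∈ Submodule.span F (intVecCast F ι '' {w | intVecCast K ι w ∈ S K}) ↔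
        ∃ c : s → F, ∀ i, v i - ∑ j, c j * (((j : ι → ℤ) i : ℤ) : F) = 0 := by
    rw [hspan, Submodule.mem_span_range_iff_exists_fun]
    refine exists_congr fun c => ?_
    rw [funext_iff]
    refine forall_congr' fun i => ?_
    rw [sub_eq_zero, eq_comm]
    simp [intVecCast]
  have hK : S K = Submodule.span K (intVecCast K ι '' {w | intVecCast K ι w ∈ S K}) := by
    refine le_antisymm ?_ (Submodule.span_le.2 (Set.image_subset_iff.2 fun w hw => hw))
    conv_lhs => rw [(S K).eq_span_rational_of_galois_stable (k := ULift.{u} ℚ)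
      fun σ v hv => (hS.comp_ringEquiv σ.toRingEquiv v).2 hv]
    refine Submodule.span_le.2 ?_
    rintro _ ⟨hv, w, rfl⟩
    obtain ⟨d, hd⟩ := IsLocalization.exist_integer_multiples_of_finite (nonZeroDivisors ℤ)
      fun i => (w i).down
    choose z hz using hd
    have hd0 : ((d : ℤ) : K) ≠ 0 := Int.cast_ne_zero.2 (nonZeroDivisors.coe_ne_zero d)
    have hzw : intVecCast K ι z = ((d : ℤ) : K) • fun i => algebraMap (ULift.{u} ℚ) K (w i) := by
      ext i
      have h : ((z i : ℤ) : ULift.{u} ℚ) = ((d : ℤ) : ULift.{u} ℚ) * w i := by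
        apply ULift.ext
        simpa using hz i
      simpa [intVecCast] using congrArg (algebraMap (ULift.{u} ℚ) K) h
    have hz' : intVecCast K ι z ∈ Submodule.span K
        (intVecCast K ι '' {w | intVecCast K ι w ∈ S K}) := by
      refine Submodule.subset_span ⟨z, ?_, rfl⟩
      rw [Set.mem_ofPred_eq, hzw]
      exact Submodule.smul_mem _ _ hv
    rw [hzw] at hz'
    exact (Submodule.smul_mem_iff _ hd0).1 hz'
  obtain ⟨M, hM⟩ := hdef.lefschetz K fun v => by rw [← hmem, ← hK]
  refine ⟨M, fun F _ _ hF => Submodule.ext fun v => ?_⟩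
  rw [hmem]
  exact hM F inferInstance inferInstance hF v

/-- The intersection of all ideals of codimension at most `m`, described through the linear maps to
`F^m` whose kernel is an ideal. -/
theorem mem_iInf_lieIdeal_iff {F V : Type*} [Field F] [LieRing V] [LieAlgebra F V]
    [Module.Finite F V] (m : ℕ) (v : V) :
    (v ∈ ⨅ (I : LieIdeal F V) (_ : Module.finrank F (V ⧸ I) < m + 1), I) ↔
      ∀ f : V →ₗ[F] (Fin m → F), (∀ y x : V, f x = 0 → f ⁅y, x⁆ = 0) → f v = 0 := by
  simp only [LieSubmodule.mem_iInf, Nat.lt_succ_iff]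
  constructor
  · intro h f hf
    let I : LieIdeal F V := { LinearMap.ker f with lie_mem := fun {y x} hx => hf y x hx }
    refine h I ?_
    have h1 : Module.finrank F (V ⧸ I) = Module.finrank F (LinearMap.range f) :=
      f.quotKerEquivRange.finrank_eq
    rw [h1]
    exact (Submodule.finrank_le _).trans (by simp)
  · intro h I hI
    obtain ⟨g, hg⟩ := finrank_le_iff_exists_linearMap.1
      (show Module.finrank F (V ⧸ I) ≤ Module.finrank F (Fin m → F) by simpa using hI)
    have hker (x : V) : (g ∘ₗ I.toSubmodule.mkQ) x = 0 ↔ x ∈ I := by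
      rw [LinearMap.comp_apply, map_eq_zero_iff g hg]
      exact Submodule.Quotient.mk_eq_zero _
    refine (hker v).1 (h _ fun y x hx => ?_)
    exact (hker _).2 (lie_mem_right F V I y x ((hker x).1 hx))

section Coordinates

variable {L : Type} [LieRing L] {ι : Type} [Fintype ι] (b : Module.Basis ι ℤ L)

theorem lie_baseChange_equivFun_symm (F : Type u) [Field F] (y x : ι → F) :
    ⁅(b.baseChange F).equivFun.symm y, (b.baseChange F).equivFun.symm x⁆ =
      (b.baseChange F).equivFun.symm fun j =>
        ∑ k, ∑ l, y k * x l * ((b.repr ⁅b k, b l⁆ j : ℤ) : F) := by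
  rw [LinearEquiv.eq_symm_apply]
  ext j
  simp only [Module.Basis.equivFun_symm_apply, sum_lie_sum, smul_lie, lie_smul,
    Module.Basis.baseChange_apply, LieAlgebra.ExtendScalars.bracket_tmul]
  simp [mul_assoc, mul_left_comm]

theorem uniformlyDefinable_iInf_lieIdeal (k : ℕ) :
    UniformlyDefinable.{u} fun F _ (v : ι → F) => (b.baseChange F).equivFun.symm v ∈
      ⨅ (I : LieIdeal F (F ⊗[ℤ] L)) (_ : Module.finrank F ((F ⊗[ℤ] L) ⧸ I) < k), I := by
  cases k with
  | zero =>
    have := UniformlyDefinable.lift_eq_zero.{u} (0 : FreeCommRing ι)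
    simpa using this
  | succ m =>
    have hdef : UniformlyDefinable.{u} fun F _ (v : ι → F) => ∀ A : Fin m × ι → F,
        (∀ y x : ι → F, (∀ r, ∑ j, A (r, j) * x j = 0) →
          ∀ r, ∑ j, A (r, j) *
            ∑ k, ∑ l, y k * x l * ((b.repr ⁅b k, b l⁆ j : ℤ) : F) = 0) →
        ∀ r, ∑ j, A (r, j) * v j = 0 := by
      refine .forall_tuple (.imp (.forall_tuple (.forall_tuple (.imp (.forall_index fun r => ?_)
        (.forall_index fun r => ?_)))) (.forall_index fun r => ?_))
      · have := UniformlyDefinable.lift_eq_zero.{u} (α := ((ι ⊕ Fin m × ι) ⊕ ι) ⊕ ι)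
          (∑ j, .of (.inl (.inl (.inr (r, j)))) * .of (.inr j))
        simpa using this
      · have := UniformlyDefinable.lift_eq_zero.{u} (α := ((ι ⊕ Fin m × ι) ⊕ ι) ⊕ ι)
          (∑ j, .of (.inl (.inl (.inr (r, j)))) * ∑ k, ∑ l, .of (.inl (.inr k)) * .of (.inr l) *
            ((b.repr ⁅b k, b l⁆ j : ℤ) : FreeCommRing (((ι ⊕ Fin m × ι) ⊕ ι) ⊕ ι)))
        simpa using this
      · have := UniformlyDefinable.lift_eq_zero.{u} (α := ι ⊕ Fin m × ι)
          (∑ j, .of (.inr (r, j)) * .of (.inl j))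
        simpa using this
    obtain ⟨φ, hφ⟩ := hdef
    refine ⟨φ, fun F _ _ v => (hφ F v).trans ?_⟩
    have := Module.Finite.of_basis (b.baseChange F)
    beta_reduce
    rw [mem_iInf_lieIdeal_iff]
    let e := (b.baseChange F).equivFun.symm
    let toMap (A : Fin m × ι → F) : F ⊗[ℤ] L →ₗ[F] (Fin m → F) :=
      (Matrix.mulVecLin (Matrix.of fun r j => A (r, j))) ∘ₗ e.symm.toLinearMap
    have htoMap (A : Fin m × ι → F) (x : ι → F) : toMap A (e x) = 0 ↔
        ∀ r, ∑ j, A (r, j) * x j = 0 := by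
      simp [toMap, funext_iff, Matrix.mulVec, dotProduct]
    have hsurj : Function.Surjective toMap := by
      intro f
      refine ⟨fun p => f (b.baseChange F p.2) p.1, (b.baseChange F).ext fun j => ?_⟩
      ext r
      classical
      simp [toMap, e, Matrix.mulVec, dotProduct, Finsupp.single_apply]
    rw [hsurj.forall]
    refine forall_congr' fun A => imp_congr ?_ (htoMap A v).symm
    rw [e.surjective.forall]
    refine forall_congr' fun y => ?_
    rw [e.surjective.forall]
    refine forall_congr' fun x => ?_
    rw [lie_baseChange_equivFun_symm, htoMap, htoMap]

end Coordinates

/-- For a nonzero Lie ring `L` with `δ = δ₂(L^ℂ,ℂ)`, there are an ideal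
`I_δ` of `L` and `M ∈ ℕ` such that over every algebraically closed field `𝔽` of
characteristic zero or `p > M`, the `𝔽`-span of the image of `I_δ` in `L^𝔽` equals the
intersection of all ideals of `L^𝔽` of codimension `< δ`. -/
theorem exists_ideal_Idelta
    (L : Type) [LieRing L] [Module.Free ℤ L] [Module.Finite ℤ L] [Nontrivial L] :
    ∃ (Iδ : LieIdeal ℤ L) (M : ℕ), ∀ (𝔽 : Type u) (_ : Field 𝔽) (_ : IsAlgClosed 𝔽),
      (ringChar 𝔽 = 0 ∨ M < ringChar 𝔽) →
        Submodule.span 𝔽 ((fun v : L => (1 : 𝔽) ⊗ₜ[ℤ] v) '' (Iδ : Set L)) =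
          LieSubmodule.toSubmodule
            (⨅ (I : LieIdeal 𝔽 (𝔽 ⊗[ℤ] L))
              (_ : Module.finrank 𝔽 ((𝔽 ⊗[ℤ] L) ⧸ I) < delta2 ℂ (ℂ ⊗[ℤ] L)), I) := by
  generalize delta2 ℂ (ℂ ⊗[ℤ] L) = k
  let b := Module.Free.chooseBasis ℤ L
  let J (F : Type u) [Field F] : LieIdeal F (F ⊗[ℤ] L) :=
    ⨅ (I : LieIdeal F (F ⊗[ℤ] L)) (_ : Module.finrank F ((F ⊗[ℤ] L) ⧸ I) < k), I
  let e (F : Type u) [Field F] := (b.baseChange F).equivFun.symm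
  obtain ⟨K, _, _, _⟩ : ∃ (K : Type u) (_ : Field K) (_ : Algebra (ULift.{u} ℚ) K),
      IsAlgClosure (ULift.{u} ℚ) K :=
    ⟨AlgebraicClosure (ULift.{u} ℚ), inferInstance, inferInstance, inferInstance⟩
  obtain ⟨M, hM⟩ := exists_forall_eq_span_intVecCast
    (fun F _ => (J F).toSubmodule.comap (e F).toLinearMap)
    (uniformlyDefinable_iInf_lieIdeal b k) K
  let Iδ : LieIdeal ℤ L :=
    { carrier := {v | (1 : K) ⊗ₜ[ℤ] v ∈ J K}
      add_mem' := fun {v w} hv hw => by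
        rw [Set.mem_ofPred_eq, TensorProduct.tmul_add]
        exact add_mem hv hw
      zero_mem' := by simp
      smul_mem' := fun c v hv => by
        rw [Set.mem_ofPred_eq, TensorProduct.tmul_smul]
        exact zsmul_mem hv c
      lie_mem := fun {y v} hv => by
        have := lie_mem_right K _ (J K) ((1 : K) ⊗ₜ[ℤ] y) _ hv
        rwa [LieAlgebra.ExtendScalars.bracket_tmul, one_mul] at this }
  refine ⟨Iδ, M, fun F _ _ hF => ?_⟩
  have he (F : Type u) [Field F] (w : _ → ℤ) :
      e F (intVecCast F _ w) = (1 : F) ⊗ₜ[ℤ] b.equivFun.symm w := by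
    simp only [e, intVecCast, Module.Basis.equivFun_symm_apply, TensorProduct.tmul_sum,
      Module.Basis.baseChange_apply, LinearMap.coe_mk, AddHom.coe_mk, TensorProduct.tmul_smul,
      Int.cast_smul_eq_zsmul]
  change _ = (J F).toSubmodule
  rw [← Submodule.map_comap_eq_of_surjective (e F).surjective (J F).toSubmodule]
  rw [show Submodule.comap _ _ = _ from hM F inferInstance inferInstance hF,
    Submodule.map_span]
  congr 1
  ext x
  simp only [Set.mem_image, exists_exists_and_eq_and]
  refine b.equivFun.symm.surjective.exists.trans (exists_congr fun w => ?_)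
  rw [LinearEquiv.coe_coe, he]
  refine and_congr_left fun _ => ?_
  change (1 : K) ⊗ₜ[ℤ] b.equivFun.symm w ∈ J K ↔ e K (intVecCast K _ w) ∈ J K
  rw [he]
end

section
/- Let L be a Lie ring and 0 ≠ v ∈ L. If I is an ideal of L of finite additive index with v ∉ I and [L:I] = D_L(v), then [L:I] = p^l for some prime p and some l ∈ ℕ. -/
noncomputable section

/-- `D_L(v) = min {[L:I] : I ideal of finite additive index, v ∉ I}`. -/
def lieDiv {L : Type*} [LieRing L] (v : L) : ℕ :=
  sInf {k | ∃ I : LieIdeal ℤ L, v ∉ I ∧ idealIndex I = k ∧ k ≠ 0}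

end

/-- The ideal of all `x` such that `m • x` lies in `I`. -/
def LieIdeal.nsmulPreimage {L : Type*} [LieRing L] (I : LieIdeal ℤ L) (m : ℕ) :
    LieIdeal ℤ L where
  __ := (LieSubmodule.toSubmodule I).comap (m • LinearMap.id : L →ₗ[ℤ] L)
  lie_mem {x y} hy := by
    change m • ⁅x, y⁆ ∈ I
    rw [← lie_nsmul]
    exact I.lie_mem hy

theorem LieIdeal.mem_nsmulPreimage {L : Type*} [LieRing L] {I : LieIdeal ℤ L} {m : ℕ} {x : L} :
    x ∈ I.nsmulPreimage m ↔ m • x ∈ I :=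
  Iff.rfl

theorem LieIdeal.le_nsmulPreimage {L : Type*} [LieRing L] (I : LieIdeal ℤ L) (m : ℕ) :
    I ≤ I.nsmulPreimage m :=
  fun _ hx => LieIdeal.mem_nsmulPreimage.2 (nsmul_mem hx m)

/-- An ideal realizing the divisibility of `v` is maximal among ideals avoiding `v`. -/
theorem mem_of_lt_of_idealIndex_eq_lieDiv {L : Type*} [LieRing L] {v : L} {I J : LieIdeal ℤ L}
    (hfin : idealIndex I ≠ 0) (hmin : idealIndex I = lieDiv v) (hIJ : I < J) : v ∈ J := by
  by_contra hvJ
  have hlt : (LieSubmodule.toSubmodule I).toAddSubgroup <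
      (LieSubmodule.toSubmodule J).toAddSubgroup := hIJ
  have hindex : idealIndex J < idealIndex I :=
    haveI : (LieSubmodule.toSubmodule I).toAddSubgroup.FiniteIndex := ⟨hfin⟩
    AddSubgroup.index_strictAnti hlt
  have hJ : idealIndex J ≠ 0 := fun h => hfin <|
    Nat.eq_zero_of_zero_dvd (h ▸ AddSubgroup.index_dvd_of_le hlt.le)
  have hle : lieDiv v ≤ idealIndex J := Nat.sInf_le ⟨J, hvJ, rfl, hJ⟩
  omega

/-- If a prime `p` divides the index of `I`, then `L ⧸ I` has nontrivial `p`-torsion. -/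
theorem LieIdeal.lt_nsmulPreimage_of_dvd_idealIndex {L : Type*} [LieRing L] {I : LieIdeal ℤ L}
    (hfin : idealIndex I ≠ 0) {p : ℕ} (hp : p.Prime) (hdvd : p ∣ idealIndex I) :
    I < I.nsmulPreimage p := by
  have : Fact p.Prime := ⟨hp⟩
  have : Finite (L ⧸ (LieSubmodule.toSubmodule I).toAddSubgroup) :=
    (AddSubgroup.finiteIndex_iff_finite_quotient).1 ⟨hfin⟩
  obtain ⟨x, hx⟩ := exists_prime_addOrderOf_dvd_card' p hdvd
  obtain ⟨x, rfl⟩ := QuotientAddGroup.mk_surjective x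
  refine lt_of_le_not_ge (I.le_nsmulPreimage p) fun hle => ?_
  have hpx : p • x ∈ I := (QuotientAddGroup.eq_zero_iff
    (N := (LieSubmodule.toSubmodule I).toAddSubgroup) (p • x)).1 <| by
      rw [QuotientAddGroup.mk_nsmul, ← hx, addOrderOf_nsmul_eq_zero]
  have hx0 : (x : L ⧸ (LieSubmodule.toSubmodule I).toAddSubgroup) = 0 :=
    (QuotientAddGroup.eq_zero_iff x).2 (hle (LieIdeal.mem_nsmulPreimage.2 hpx))
  rw [hx0, addOrderOf_zero] at hx
  exact hp.one_lt.ne hx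

/-- If `0 ≠ v ∈ L` and the ideal `I` realizes `D_L(v)`, then `[L:I]` is a
prime power. -/
theorem divisibility_realizer_is_prime_power
    {L : Type*} [LieRing L] [Module.Free ℤ L] [Module.Finite ℤ L]
    (v : L) (hv : v ≠ 0) (I : LieIdeal ℤ L) (hvI : v ∉ I)
    (hfin : idealIndex I ≠ 0) (hmin : idealIndex I = lieDiv v) :
    ∃ p l : ℕ, p.Prime ∧ 0 < l ∧ idealIndex I = p ^ l := by
  have hone : idealIndex I ≠ 1 := fun h => hvI <| by
    have htop := AddSubgroup.index_eq_one.1 h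
    have hmem : v ∈ (LieSubmodule.toSubmodule I).toAddSubgroup := htop ▸ AddSubgroup.mem_top v
    exact hmem
  have hsmul {q : ℕ} (hq : q.Prime) (hdvd : q ∣ idealIndex I) : q • v ∈ I :=
    LieIdeal.mem_nsmulPreimage.1 <| mem_of_lt_of_idealIndex_eq_lieDiv hfin hmin <|
      LieIdeal.lt_nsmulPreimage_of_dvd_idealIndex hfin hq hdvd
  obtain ⟨p, hp, hpI⟩ := Nat.exists_prime_and_dvd hone
  have hpow := Nat.eq_prime_pow_of_unique_prime_dvd (p := p) hfin fun {q} hq hqI => by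
    by_contra hne
    have hcop : IsCoprime (q : ℤ) (p : ℤ) :=
      Nat.isCoprime_iff_coprime.2 ((Nat.coprime_primes hq hp).2 hne)
    obtain ⟨a, b, hab⟩ := hcop
    apply hvI
    rw [← one_smul ℤ v, ← hab, add_smul, mul_smul, mul_smul, natCast_zsmul, natCast_zsmul]
    exact add_mem (zsmul_mem (hsmul hq hqI) a) (zsmul_mem (hsmul hp hpI) b)
  refine ⟨p, _, hp, Nat.pos_of_ne_zero fun h => hone ?_, hpow⟩
  rw [hpow, h, pow_zero]
end

section
/- Let L be a Lie ring and let 𝒫^∞ be the set of ideals I of L such that p^l·L ⊆ I for some prime power p^l. Then for every nonzero v ∈ L, D_L(v) = D_{L,𝒫^∞}(v); consequently, for any norm or Guivarc'h length ℓ on L, RF_{L,ℓ}(r) = RF_{L,𝒫^∞,ℓ}(r) for all r ≥ 1. -/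
open scoped TensorProduct

/-- Enlarging a finite-index ideal that avoids `v` to one that moreover contains `p ^ l • L`. -/
theorem exists_le_primePow_smul_mem {L : Type*} [LieRing L] (I : LieIdeal ℤ L) {v : L}
    (hv : v ∉ I) (hI : idealIndex I ≠ 0) :
    ∃ J : LieIdeal ℤ L, I ≤ J ∧ v ∉ J ∧ ∃ p l : ℕ, p.Prime ∧ 0 < l ∧
      ∀ w : L, ((p : ℤ) ^ l) • w ∈ J := by
  let H : AddSubgroup L := (LieSubmodule.toSubmodule I).toAddSubgroup
  have hne : addOrderOf (QuotientAddGroup.mk v : L ⧸ H) ≠ 1 := by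
    rw [Ne, AddMonoid.addOrderOf_eq_one_iff, QuotientAddGroup.eq_zero_iff]
    exact hv
  obtain ⟨p, hp, hpd⟩ := Nat.exists_prime_and_dvd hne
  obtain ⟨a, m, hpm, hn⟩ := Nat.exists_eq_pow_mul_and_not_dvd hI p hp.ne_one
  let f : L →ₗ⁅ℤ, L⁆ L := (m : ℤ) • LieModuleHom.id
  refine ⟨LieSubmodule.comap f I, fun w hw => ?_, fun h => hpm (hpd.trans ?_), p, a + 1, hp, a.succ_pos,
    fun w => ?_⟩
  · exact I.smul_mem (m : ℤ) hw
  · rw [addOrderOf_dvd_iff_nsmul_eq_zero, ← QuotientAddGroup.mk_nsmul,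
      QuotientAddGroup.eq_zero_iff, ← natCast_zsmul]
    exact h
  · have hw : idealIndex I • w ∈ H := H.nsmul_index_mem w
    have key : (p : ℤ) • idealIndex I • w ∈ I := I.smul_mem (p : ℤ) hw
    have heq : f (((p : ℤ) ^ (a + 1)) • w) = (p : ℤ) • idealIndex I • w := by
      change (m : ℤ) • ((p : ℤ) ^ (a + 1)) • w = _
      rw [hn, ← natCast_zsmul, smul_smul, smul_smul]
      congr 1
      push_cast
      ring
    rw [LieSubmodule.mem_comap, heq]
    exact key

/-- The divisibility function of a Lie ring only sees ideals containing some `p ^ l • L`. -/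
theorem lieDivP_univ_eq_primePowers {L : Type*} [LieRing L] (v : L) :
    lieDivP (Set.univ : Set (LieIdeal ℤ L)) v =
      lieDivP {I : LieIdeal ℤ L | ∃ p l : ℕ, p.Prime ∧ 0 < l ∧
        ∀ w : L, ((p : ℤ) ^ l) • w ∈ I} v := by
  refine csInf_eq_csInf_of_forall_exists_le ?_ ?_
  · rintro _ ⟨I, -, hv, rfl, hI⟩
    obtain ⟨J, hIJ, hvJ, hJ⟩ := exists_le_primePow_smul_mem I hv hI
    have hdvd : idealIndex J ∣ idealIndex I := AddSubgroup.index_dvd_of_le hIJ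
    exact ⟨_, ⟨J, hJ, hvJ, rfl, ne_zero_of_dvd_ne_zero hI hdvd⟩,
      Nat.le_of_dvd (Nat.pos_of_ne_zero hI) hdvd⟩
  · rintro k ⟨I, -, h⟩
    exact ⟨k, ⟨I, Set.mem_univ I, h⟩, le_rfl⟩


/-- With `𝒫^∞` the set of ideals of `L` containing `p^l·L` for some prime
power `p^l`, we have `D_L(v) = D_{L,𝒫^∞}(v)` for all `0 ≠ v ∈ L`; consequently for any norm
or Guivarc'h length `ℓ` on `L`, `RF_{L,ℓ}(r) = RF_{L,𝒫^∞,ℓ}(r)` for all `r ≥ 1`. -/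
theorem lieDiv_eq_lieDiv_primePowers
    {L : Type*} [LieRing L] [Module.Free ℤ L] [Module.Finite ℤ L] :
    (∀ v : L, v ≠ 0 →
      lieDivP (Set.univ : Set (LieIdeal ℤ L)) v =
        lieDivP {I : LieIdeal ℤ L | ∃ p l : ℕ, p.Prime ∧ 0 < l ∧
          ∀ w : L, ((p : ℤ) ^ l) • w ∈ I} v) ∧
    (∀ ℓ : L → ℝ, (IsLieRingNorm ℓ ∨ ∃ c : ℕ, IsGuivarchLength c ℓ) →
      ∀ r : ℝ, 1 ≤ r →
        lieRF L ℓ r =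
          lieRFP L {I : LieIdeal ℤ L | ∃ p l : ℕ, p.Prime ∧ 0 < l ∧
            ∀ w : L, ((p : ℤ) ^ l) • w ∈ I} ℓ r) := by
  refine ⟨fun v _ => lieDivP_univ_eq_primePowers v, fun ℓ _ r _ => ?_⟩
  simp only [lieRF, lieRFP, lieDivP_univ_eq_primePowers]
end
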